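/- arXiv:0710.3036 — 6 statements merged into one kernel-verified Lean document; each statement's English description precedes it below -/
import Mathlib

section
/- Let B be a finite set and b = (b_1,…,b_m) a sequence of integers with 1 ≤ b_1 < b_2 < ⋯ < b_m ≤ |B|. Let F ⊆ B satisfy b_p < |F| < b_{p+1} for some p ∈ {1,…,m−1}. Then: (a) for every H ⊆ B with |H| = b_q for some q ∈ {1,…,m}, one has (b_{p+1} − |F|)·|H ∩ F| − (|F| − b_p)·|H \ F| ≤ b_p·(b_{p+1} − |F|), with equality if |H| = b_p and H ⊆ F, and also with equality if |H| = b_{p+1} and F ⊆ H; (b) the set F itself violates this inequality, i.e. (b_{p+1} − |F|)·|F| > b_p·(b_{p+1} − |F|). -/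
/-- **Cardinality forcing inequalities for cardinality homogeneous set systems.**
Let `B` be a finite set and `b = (b 0, …, b (m-1))` a cardinality sequence
(`1 ≤ b 0 < ⋯ < b (m-1) ≤ |B|`).  Let `F ⊆ B` have forbidden cardinality, i.e.
`b p < |F| < b q` for consecutive indices `p, q`.  Then
(a) every `H ⊆ B` whose cardinality is some `b r` satisfies the cardinality forcing
inequality `(b q − |F|)·|H ∩ F| − (|F| − b p)·|H \ F| ≤ b p·(b q − |F|)`, with equality
when `|H| = b p ∧ H ⊆ F` and also when `|H| = b q ∧ F ⊆ H`; and
(b) `F` itself violates this inequality. -/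
theorem cardinality_forcing_CHS {α : Type*} [DecidableEq α] (B : Finset α)
    (m : ℕ) (b : Fin m → ℕ) (hmono : StrictMono b)
    (hb1 : ∀ p, 1 ≤ b p) (hbB : ∀ p, b p ≤ B.card)
    (F : Finset α) (hFB : F ⊆ B)
    (p q : Fin m) (hpq : (q : ℕ) = (p : ℕ) + 1)
    (h1 : b p < F.card) (h2 : F.card < b q) :
    (∀ H : Finset α, H ⊆ B → (∃ r, H.card = b r) →
      (((b q : ℤ) - F.card) * (H ∩ F).card - ((F.card : ℤ) - b p) * (H \ F).card
          ≤ (b p : ℤ) * ((b q : ℤ) - F.card)) ∧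
      ((H.card = b p ∧ H ⊆ F) →
        ((b q : ℤ) - F.card) * (H ∩ F).card - ((F.card : ℤ) - b p) * (H \ F).card
          = (b p : ℤ) * ((b q : ℤ) - F.card)) ∧
      ((H.card = b q ∧ F ⊆ H) →
        ((b q : ℤ) - F.card) * (H ∩ F).card - ((F.card : ℤ) - b p) * (H \ F).card
          = (b p : ℤ) * ((b q : ℤ) - F.card))) ∧
    ((b p : ℤ) * ((b q : ℤ) - F.card) < ((b q : ℤ) - F.card) * F.card) := by
  have hPF : (0 : ℤ) < (F.card : ℤ) - b p := by lia
  have hFQ : (0 : ℤ) < (b q : ℤ) - F.card := by lia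
  refine ⟨fun H _ ⟨r, hr⟩ ↦ ⟨?_, ?_, ?_⟩, by nlinarith⟩
  · have hsum : ((H ∩ F).card : ℤ) + (H \ F).card = b r := by
      exact_mod_cast (Finset.card_inter_add_card_sdiff H F).trans hr
    have hle : ((H ∩ F).card : ℤ) ≤ F.card := by
      exact_mod_cast Finset.card_le_card Finset.inter_subset_right
    have hnonneg : (0 : ℤ) ≤ (H \ F).card := by positivity
    rcases le_or_gt r p with hrp | hrp
    · have hb : (b r : ℤ) ≤ b p := by exact_mod_cast hmono.monotone hrp
      have hx : ((H ∩ F).card : ℤ) ≤ b p := by linarith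
      nlinarith [mul_le_mul_of_nonneg_left hx hFQ.le, mul_nonneg hPF.le hnonneg]
    · have hqr : q ≤ r := by
        rw [Fin.le_def, hpq]
        exact hrp
      have hb : (b q : ℤ) ≤ b r := by exact_mod_cast hmono.monotone hqr
      have hy : (b q : ℤ) - (H ∩ F).card ≤ (H \ F).card := by linarith
      nlinarith [mul_le_mul_of_nonneg_left hy hPF.le,
        mul_le_mul_of_nonneg_left hle (add_pos hPF hFQ).le]
  · rintro ⟨hcard, hHF⟩
    rw [Finset.inter_eq_left.mpr hHF, Finset.sdiff_eq_empty_iff_subset.mpr hHF, hcard,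
      Finset.card_empty]
    push_cast
    ring
  · rintro ⟨hcard, hFH⟩
    have hdiff : ((H \ F).card : ℤ) = b q - F.card := by
      rw [Finset.cast_card_sdiff hFH, hcard]
    rw [Finset.inter_eq_right.mpr hFH, hdiff]
    ring
end

section
/- Let D = (N, A) be a digraph without loops and parallel arcs, and let c = (c_1,…,c_m) be a cardinality sequence with 2 ≤ c_1 < ⋯ < c_m ≤ |N|. Let W ⊆ N satisfy c_p < |W| < c_{p+1} for some p ∈ {1,…,m−1}. Then: (a) for every simple directed cycle C in D with |C| = c_q for some q ∈ {1,…,m}, its incidence vector x = χ^C satisfies (c_{p+1} − |W|)·Σ_{i∈W} x(δ^out(i)) − (|W| − c_p)·Σ_{i∈N∖W} x(δ^out(i)) ≤ c_p·(c_{p+1} − |W|); (b) every simple directed cycle C with c_p < |C| < c_{p+1} that visits exactly min{|C|, |W|} nodes of W violates this inequality. -/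
open Finset

/-- A simple directed cycle in a digraph on the node set `Fin N`, encoded by its arc set:
there is an injective map `f` from the cyclically ordered index set `Fin (k+2)` (so the
cycle has length at least `2`) to the nodes, whose consecutive pairs are exactly the arcs
of `C`. -/
def IsSimpleCycle {N : ℕ} (C : Finset (Fin N × Fin N)) : Prop :=
  ∃ (k : ℕ) (f : Fin (k + 2) → Fin N), Function.Injective f ∧
    C = Finset.image (fun i : Fin (k + 2) => (f i, f (i + 1))) Finset.univ

/-- Incidence vector of an arc set. -/
noncomputable def incVec {N : ℕ} (C : Finset (Fin N × Fin N)) : Fin N → Fin N → ℝ :=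
  fun i j => if (i, j) ∈ C then 1 else 0

theorem IsSimpleCycle.injOn_fst {N : ℕ} {C : Finset (Fin N × Fin N)} (hC : IsSimpleCycle C) :
    Set.InjOn Prod.fst (C : Set (Fin N × Fin N)) := by
  obtain ⟨k, f, hf, rfl⟩ := hC
  intro a ha b hb hab
  simp only [coe_image, coe_univ, Set.image_univ, Set.mem_range] at ha hb
  obtain ⟨i, rfl⟩ := ha
  obtain ⟨j, rfl⟩ := hb
  obtain rfl : i = j := hf hab
  rfl

/-- For a simple cycle `C`, summing `x(δ^out(i))` over `i ∈ S` counts the nodes of `S` visited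
by `C`. -/
theorem IsSimpleCycle.sum_out_incVec {N : ℕ} {A C : Finset (Fin N × Fin N)} (hCA : C ⊆ A)
    (hC : IsSimpleCycle C) (S : Finset (Fin N)) :
    ∑ i ∈ S, ∑ a ∈ A.filter (fun a => a.1 = i), incVec C a.1 a.2 =
      ((S ∩ C.image Prod.fst).card : ℝ) := by
  have hout (i : Fin N) : ∑ a ∈ A.filter (fun a => a.1 = i), incVec C a.1 a.2 =
      ((C.filter (fun a => a.1 = i)).card : ℝ) := by
    simp only [incVec, Prod.mk.eta, sum_boole, filter_filter]
    congr 2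
    ext a
    simp only [mem_filter]
    exact ⟨fun h => ⟨h.2.2, h.2.1⟩, fun h => ⟨hCA h.1, h.2, h.1⟩⟩
  have himage : S ∩ C.image Prod.fst = (C.filter (fun a => a.1 ∈ S)).image Prod.fst := by
    ext i
    simp only [mem_inter, mem_image, mem_filter]
    constructor
    · rintro ⟨hi, a, ha, rfl⟩
      exact ⟨a, ⟨ha, hi⟩, rfl⟩
    · rintro ⟨a, ⟨ha, hi⟩, rfl⟩
      exact ⟨hi, a, ha, rfl⟩
  rw [sum_congr rfl fun i _ => hout i, himage,
    card_image_of_injOn (hC.injOn_fst.mono (coe_subset.2 (filter_subset _ _))),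
    card_eq_sum_card_fiberwise (s := C.filter (fun a => a.1 ∈ S)) (f := Prod.fst) (t := S)
      (fun a ha => mem_coe.2 (mem_filter.1 (mem_coe.1 ha)).2)]
  push_cast
  refine sum_congr rfl fun i hi => ?_
  rw [filter_filter]
  congr 2
  ext a
  simp only [mem_filter]
  exact ⟨fun h => ⟨h.1, h.2 ▸ hi, h.2⟩, fun h => ⟨h.1, h.2.2⟩⟩

theorem IsSimpleCycle.card_inter_add_card_sdiff {N : ℕ} {C : Finset (Fin N × Fin N)}
    (hC : IsSimpleCycle C) (W : Finset (Fin N)) :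
    (W ∩ C.image Prod.fst).card + ((univ \ W) ∩ C.image Prod.fst).card = C.card := by
  rw [← card_image_of_injOn hC.injOn_fst, ← card_union_of_disjoint, ← union_inter_distrib_right,
    union_sdiff_of_subset (subset_univ W), univ_inter]
  exact disjoint_sdiff.mono inter_subset_left inter_subset_left

/-- **Cardinality forcing inequalities for cycle polytopes.**  Let `D = (Fin n, A)` be a
loopless digraph, `c` a cardinality sequence with `2 ≤ c 0 < ⋯ < c (m-1) ≤ n`, and
`W ⊆ N` with `c p < |W| < c q` for consecutive indices `p, q`.  Then
(a) the incidence vector of every simple directed cycle `C ⊆ A` with `|C| = c r` for some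
`r` satisfies `(c q − |W|)·Σ_{i∈W} x(δ^out(i)) − (|W| − c p)·Σ_{i∉W} x(δ^out(i))
≤ c p·(c q − |W|)`; and
(b) every simple directed cycle `C ⊆ A` with `c p < |C| < c q` that visits exactly
`min {|C|, |W|}` nodes of `W` violates this inequality. -/
theorem cardinality_forcing_cycles
    (n : ℕ) (A : Finset (Fin n × Fin n)) (hA : ∀ a ∈ A, a.1 ≠ a.2)
    (m : ℕ) (c : Fin m → ℕ) (hmono : StrictMono c)
    (hc2 : ∀ p, 2 ≤ c p) (hcn : ∀ p, c p ≤ n)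
    (W : Finset (Fin n)) (p q : Fin m) (hpq : (q : ℕ) = (p : ℕ) + 1)
    (hW1 : c p < W.card) (hW2 : W.card < c q) :
    (∀ C : Finset (Fin n × Fin n), C ⊆ A → IsSimpleCycle C → (∃ r, C.card = c r) →
      ((c q : ℝ) - W.card) *
          (∑ i ∈ W, ∑ a ∈ A.filter (fun a => a.1 = i), incVec C a.1 a.2)
        - ((W.card : ℝ) - c p) *
            (∑ i ∈ Finset.univ \ W, ∑ a ∈ A.filter (fun a => a.1 = i), incVec C a.1 a.2)
        ≤ (c p : ℝ) * ((c q : ℝ) - W.card)) ∧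
    (∀ C : Finset (Fin n × Fin n), C ⊆ A → IsSimpleCycle C →
      c p < C.card → C.card < c q →
      (W ∩ C.image Prod.fst).card = min C.card W.card →
      (c p : ℝ) * ((c q : ℝ) - W.card) <
        ((c q : ℝ) - W.card) *
            (∑ i ∈ W, ∑ a ∈ A.filter (fun a => a.1 = i), incVec C a.1 a.2)
          - ((W.card : ℝ) - c p) *
              (∑ i ∈ Finset.univ \ W, ∑ a ∈ A.filter (fun a => a.1 = i), incVec C a.1 a.2)) := by
  have hp : (c p : ℝ) < W.card := by exact_mod_cast hW1
  have hq : (W.card : ℝ) < c q := by exact_mod_cast hW2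
  constructor
  · rintro C hCA hC ⟨r, hr⟩
    rw [hC.sum_out_incVec hCA, hC.sum_out_incVec hCA]
    have hcard := hC.card_inter_add_card_sdiff W
    have hle : (W ∩ C.image Prod.fst).card ≤ W.card := card_le_card inter_subset_left
    generalize (W ∩ C.image Prod.fst).card = a at *
    generalize ((univ \ W) ∩ C.image Prod.fst).card = b at *
    have hb : (0 : ℝ) ≤ b := b.cast_nonneg
    rcases le_or_gt (r : ℕ) p with h | h
    · have hrp : c r ≤ c p := hmono.monotone h
      have ha : (a : ℝ) ≤ c p := by exact_mod_cast (by omega : a ≤ c p)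
      nlinarith [mul_nonneg (sub_nonneg.2 hq.le) (sub_nonneg.2 ha),
        mul_nonneg (sub_nonneg.2 hp.le) hb]
    · have hqr : c q ≤ c r := hmono.monotone (Fin.le_def.2 (by omega))
      have hab : (c q : ℝ) ≤ a + b := by exact_mod_cast (by omega : c q ≤ a + b)
      have ha : (a : ℝ) ≤ W.card := by exact_mod_cast hle
      nlinarith [mul_nonneg (sub_nonneg.2 hp.le) (sub_nonneg.2 hab),
        mul_nonneg (sub_nonneg.2 (hp.trans hq).le) (sub_nonneg.2 ha)]
  · intro C hCA hC hpC hCq hmin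
    rw [hC.sum_out_incVec hCA, hC.sum_out_incVec hCA]
    have hcard := hC.card_inter_add_card_sdiff W
    generalize (W ∩ C.image Prod.fst).card = a at *
    generalize ((univ \ W) ∩ C.image Prod.fst).card = b at *
    rcases le_total C.card W.card with h | h
    · rw [min_eq_left h] at hmin
      obtain rfl : b = 0 := by omega
      have ha : (c p : ℝ) < a := by exact_mod_cast (by omega : c p < a)
      rw [Nat.cast_zero]
      nlinarith [mul_pos (sub_pos.2 hq) (sub_pos.2 ha)]
    · rw [min_eq_right h] at hmin
      subst hmin
      have hb : (W.card : ℝ) + b < c q := by exact_mod_cast (by omega : W.card + b < c q)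
      nlinarith [mul_pos (sub_pos.2 hp) (sub_pos.2 hb)]
end

section
/- Let D_n = (N, A) be the complete digraph on n ≥ 3 nodes and let c = (c_1,…,c_m) be a cardinality sequence with m ≥ 2 and 2 ≤ c_1 < ⋯ < c_m ≤ n. Then the dimension of the cardinality constrained cycle polytope P_C^c(D_n) equals (n−1)². -/
open Finset

/-- The cardinality constrained cycle polytope `P_C^c(D_N)` of the complete digraph on
`Fin N`: the convex hull of the incidence vectors of simple directed cycles whose
cardinality is `c p` for some `p`. -/
noncomputable def cyclePolytope (N : ℕ) {m : ℕ} (c : Fin m → ℕ) :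
    Set (Fin N → Fin N → ℝ) :=
  convexHull ℝ {x | ∃ C : Finset (Fin N × Fin N), IsSimpleCycle C ∧
    (∃ p, C.card = c p) ∧ x = incVec C}

/-- `x(δ^out(i))` in the complete digraph on `Fin N`. -/
noncomputable def outSum {N : ℕ} (x : Fin N → Fin N → ℝ) (i : Fin N) : ℝ :=
  ∑ j ∈ Finset.univ.erase i, x i j

/-- The dimension (of the affine hull) of a subset of a real vector space. -/
noncomputable def adim {V : Type*} [AddCommGroup V] [Module ℝ V] (P : Set V) : ℕ :=
  Module.finrank ℝ (vectorSpan ℝ P)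

/-- The valid inequality `f x ≤ b` defines a facet of `P`: it is valid and its face has
dimension `(dim P) - 1`. -/
def IsFacetLE {V : Type*} [AddCommGroup V] [Module ℝ V] (P : Set V) (f : V → ℝ) (b : ℝ) :
    Prop :=
  (∀ x ∈ P, f x ≤ b) ∧ adim {x ∈ P | f x = b} + 1 = adim P

/-- The sum of the arc weights `a` along the closed walk through the nodes of `l`. -/
def cycleSum {V : Type*} (a : V → V → ℝ) (l : List V) : ℝ :=
  (List.zipWith a l (l.rotate 1)).sum

lemma cycleSum_eq_sum_fin {V : Type*} (a : V → V → ℝ) (l : List V) (k : ℕ)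
    (h : l.length = k + 2) :
    cycleSum a l = ∑ i : Fin (k + 2), a (l.get (i.cast h.symm)) (l.get ((i + 1).cast h.symm)) := by
  rw [cycleSum, ← List.sum_ofFn]
  congr 1
  apply List.ext_getElem
  · simp [h]
  · intro i h1 h2
    simp [List.getElem_rotate, Fin.val_add, h, List.getElem_ofFn, -List.ofFn_succ]

lemma exists_nodup_list_avoiding {V : Type*} [Fintype V] [DecidableEq V] (S : Finset V) (m : ℕ)
    (h : S.card + m ≤ Fintype.card V) :
    ∃ l : List V, l.Nodup ∧ l.length = m ∧ ∀ x ∈ l, x ∉ S := by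
  obtain ⟨T, hT, hc⟩ := Finset.exists_subset_card_eq (s := Sᶜ) (n := m)
    (by rw [Finset.card_compl]; omega)
  exact ⟨T.toList, T.nodup_toList, by simp [hc], fun x hx => by
    simpa using hT (Finset.mem_toList.1 hx)⟩

/-- If all cycles of length `r` have the same weight, then exchanging a node of such a cycle for
a node outside of it does not change the weight of the two arcs involved. -/
lemma exchange_of_cycleSum_const {N : ℕ} {a : Fin N → Fin N → ℝ} {r : ℕ} {α : ℝ}
    (hr : 3 ≤ r) (hrN : r < N)
    (H : ∀ l : List (Fin N), l.Nodup → l.length = r → cycleSum a l = α)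
    {u v w x : Fin N} (huv : u ≠ v) (huw : u ≠ w) (hux : u ≠ x) (hvw : v ≠ w) (hvx : v ≠ x)
    (hwx : w ≠ x) : a u v + a v x = a u w + a w x := by
  obtain ⟨l, hl, hlen, hav⟩ := exists_nodup_list_avoiding ({u, v, w, x} : Finset (Fin N)) (r - 3)
    (by simp [huv, huw, hux, hvw, hvx, hwx]; omega)
  have hu : u ∉ l := fun h => hav _ h (by simp)
  have hv : v ∉ l := fun h => hav _ h (by simp)
  have hw : w ∉ l := fun h => hav _ h (by simp)
  have hx : x ∉ l := fun h => hav _ h (by simp)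
  have h1 := H (u :: v :: x :: l) (by simp [*]) (by simp; omega)
  have h2 := H (u :: w :: x :: l) (by simp [*]) (by simp; omega)
  simp [cycleSum] at h1 h2
  linarith

/-- If all cycles of length `r` have the same weight, then so have the paths `u → v → w → x` and
`u → w → v → x`. -/
lemma swap_of_cycleSum_const {N : ℕ} {a : Fin N → Fin N → ℝ} {r : ℕ} {α : ℝ}
    (hr : 4 ≤ r) (hrN : r ≤ N)
    (H : ∀ l : List (Fin N), l.Nodup → l.length = r → cycleSum a l = α)
    {u v w x : Fin N} (huv : u ≠ v) (huw : u ≠ w) (hux : u ≠ x) (hvw : v ≠ w) (hvx : v ≠ x)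
    (hwx : w ≠ x) : a u v + a v w + a w x = a u w + a w v + a v x := by
  obtain ⟨l, hl, hlen, hav⟩ := exists_nodup_list_avoiding ({u, v, w, x} : Finset (Fin N)) (r - 4)
    (by simp [huv, huw, hux, hvw, hvx, hwx]; omega)
  have hu : u ∉ l := fun h => hav _ h (by simp)
  have hv : v ∉ l := fun h => hav _ h (by simp)
  have hw : w ∉ l := fun h => hav _ h (by simp)
  have hx : x ∉ l := fun h => hav _ h (by simp)
  have h1 := H (u :: v :: w :: x :: l) (by simp [*]) (by simp; omega)
  have h2 := H (u :: w :: v :: x :: l) (by simp [*, hvw.symm]) (by simp; omega)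
  simp [cycleSum] at h1 h2
  linarith

/-- Adding the weights of a cycle and of its reversal. -/
lemma two_mul_eq_of_symm_const {N : ℕ} {a : Fin N → Fin N → ℝ} {k : ℕ} {α s : ℝ}
    (hk : k + 2 ≤ N)
    (H : ∀ g : Fin (k + 2) → Fin N, Function.Injective g → ∑ i, a (g i) (g (i + 1)) = α)
    (hs : ∀ u v, u ≠ v → a u v + a v u = s) : 2 * α = (k + 2 : ℕ) * s := by
  have hinj : Function.Injective (Fin.castLE hk) := Fin.castLE_injective hk
  have h1 := H _ hinj
  have h2 := H (fun i => Fin.castLE hk (-i)) (hinj.comp neg_injective)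
  have h3 : ∑ i : Fin (k + 2), a (Fin.castLE hk (-i)) (Fin.castLE hk (-(i + 1))) =
      ∑ i : Fin (k + 2), a (Fin.castLE hk (i + 1)) (Fin.castLE hk i) := by
    rw [← Equiv.sum_comp (Equiv.subLeft (-1 : Fin (k + 2)))]
    refine Finset.sum_congr rfl fun i _ => ?_
    congr 2 <;> simp [Equiv.subLeft]
  rw [h3] at h2
  have h4 : ∑ i : Fin (k + 2), (a (Fin.castLE hk i) (Fin.castLE hk (i + 1)) +
      a (Fin.castLE hk (i + 1)) (Fin.castLE hk i)) = ∑ i : Fin (k + 2), s :=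
    Finset.sum_congr rfl fun i _ => hs _ _ fun h => by
      have := hinj h
      simp at this
  rw [Finset.sum_add_distrib, h1, h2] at h4
  simp at h4
  push_cast
  linarith

lemma exists_potential_of_triangle {V : Type*} [Nonempty V] {a : V → V → ℝ}
    (hs : ∀ u v, u ≠ v → a u v + a v u = 0)
    (hT : ∀ u v w, u ≠ v → u ≠ w → v ≠ w → a u v + a v w + a w u = 0) :
    ∃ π : V → ℝ, ∀ i j, i ≠ j → a i j = π i - π j := by
  classical
  obtain ⟨r⟩ := ‹Nonempty V›
  refine ⟨fun u => if u = r then 0 else a u r, fun i j hij => ?_⟩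
  by_cases hi : i = r
  · subst hi
    have := hs i j hij
    simp [hij.symm]
    linarith
  · by_cases hj : j = r
    · subst hj
      simp [hij]
    · have h1 := hT i j r hij hi hj
      have h2 := hs i r hi
      simp [hi, hj]
      linarith

lemma exists_ne_of_card_lt {N : ℕ} (S : Finset (Fin N)) (h : S.card < N) : ∃ x, x ∉ S := by
  obtain ⟨x, -, hx⟩ := Finset.exists_mem_notMem_of_card_lt_card (s := S) (t := Finset.univ)
    (by simpa using h)
  exact ⟨x, hx⟩

/-- Arc weights that are constant on the cycles of two different lengths are induced by a
potential. -/
theorem exists_potential_of_cycleSum_const {N : ℕ} {a : Fin N → Fin N → ℝ} {p q : ℕ} {α : ℝ}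
    (hp : 2 ≤ p) (hpq : p < q) (hq : q ≤ N)
    (H : ∀ (k : ℕ) (g : Fin (k + 2) → Fin N), Function.Injective g → (k + 2 = p ∨ k + 2 = q) →
      ∑ i, a (g i) (g (i + 1)) = α) :
    ∃ π : Fin N → ℝ, ∀ i j, i ≠ j → a i j = π i - π j := by
  have hne : Nonempty (Fin N) := ⟨⟨0, by omega⟩⟩
  have HL : ∀ l : List (Fin N), l.Nodup → (l.length = p ∨ l.length = q) → cycleSum a l = α := by
    intro l hl hlen
    obtain ⟨k, hk⟩ : ∃ k, l.length = k + 2 := ⟨l.length - 2, by omega⟩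
    rw [cycleSum_eq_sum_fin a l k hk]
    exact H k (fun i => l.get (i.cast hk.symm))
      ((List.nodup_iff_injective_get.1 hl).comp (Fin.cast_injective _)) (by omega)
  have HP := fun l hl h => HL l hl (Or.inl h)
  have HQ := fun l hl h => HL l hl (Or.inr h)
  have hrev : ∀ s, (∀ u v, u ≠ v → a u v + a v u = s) → 2 * α = p * s ∧ 2 * α = q * s := by
    intro s hs
    obtain ⟨k, rfl⟩ : ∃ k, p = k + 2 := ⟨p - 2, by omega⟩
    obtain ⟨k', rfl⟩ : ∃ k', q = k' + 2 := ⟨q - 2, by omega⟩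
    exact ⟨two_mul_eq_of_symm_const (by omega) (fun g hg => H k g hg (Or.inl rfl)) hs,
      two_mul_eq_of_symm_const (by omega) (fun g hg => H k' g hg (Or.inr rfl)) hs⟩
  have hpq' : (p : ℝ) < q := by exact_mod_cast hpq
  have hanti : ∀ s, (∀ u v, u ≠ v → a u v + a v u = s) → s = 0 ∧ α = 0 := by
    intro s hs
    obtain ⟨h1, h2⟩ := hrev s hs
    have hs0 : s = 0 := by
      have : ((q : ℝ) - p) * s = 0 := by linarith
      rcases mul_eq_zero.1 this with h | h
      · linarith
      · exact h
    subst hs0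
    exact ⟨rfl, by linarith⟩
  rcases hp.eq_or_lt with rfl | hp3
  · have hs : ∀ u v, u ≠ v → a u v + a v u = α := fun u v huv => by
      simpa [cycleSum] using HP [u, v] (by simp [huv]) rfl
    obtain ⟨-, rfl⟩ := hanti α hs
    refine exists_potential_of_triangle hs fun u v w huv huw hvw => ?_
    by_cases hq3 : q = 3
    · simpa [cycleSum, add_assoc] using HQ [u, v, w] (by simp [huv, huw, hvw]) hq3.symm
    · obtain ⟨x, hx⟩ := exists_ne_of_card_lt {u, v, w}
        ((Finset.card_le_three).trans_lt (by omega))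
      simp only [Finset.mem_insert, Finset.mem_singleton, not_or] at hx
      obtain ⟨hxu, hxv, hxw⟩ := hx
      have e1 := swap_of_cycleSum_const (by omega) hq HQ huv huw (Ne.symm hxu) hvw (Ne.symm hxv)
        (Ne.symm hxw)
      have e2 := swap_of_cycleSum_const (by omega) hq HQ hvw (Ne.symm huv) (Ne.symm hxv)
        (Ne.symm huw) (Ne.symm hxw) (Ne.symm hxu)
      have e3 := swap_of_cycleSum_const (by omega) hq HQ (Ne.symm huw) (Ne.symm hvw)
        (Ne.symm hxw) huv (Ne.symm hxu) (Ne.symm hxv)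
      linarith [hs u v huv, hs u w huw, hs v w hvw, hs x u hxu, hs x v hxv, hs x w hxw]
  · by_cases hN : N = 4
    · obtain ⟨rfl, rfl⟩ : p = 3 ∧ q = 4 := by omega
      have tri : ∀ u v w, u ≠ v → u ≠ w → v ≠ w → a u v + a v w + a w u = α :=
        fun u v w huv huw hvw => by
          simpa [cycleSum, add_assoc] using HP [u, v, w] (by simp [huv, huw, hvw]) rfl
      have ins : ∀ u v w, u ≠ v → u ≠ w → v ≠ w → a w u = a w v + a v u := by
        intro u v w huv huw hvw
        obtain ⟨x, hx⟩ := exists_ne_of_card_lt {u, v, w}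
          ((Finset.card_le_three).trans_lt (by omega))
        simp only [Finset.mem_insert, Finset.mem_singleton, not_or] at hx
        obtain ⟨hxu, hxv, hxw⟩ := hx
        have h1 := tri u x w (Ne.symm hxu) huw hxw
        have h2 := HQ [u, x, w, v] (by simp [*, Ne.symm hxu, Ne.symm hvw]) rfl
        simp [cycleSum] at h2
        linarith
      have hs : ∀ u v, u ≠ v → a u v + a v u = α := by
        intro u v huv
        obtain ⟨x, hx⟩ := exists_ne_of_card_lt {u, v}
          ((Finset.card_le_two).trans_lt (by omega))
        simp only [Finset.mem_insert, Finset.mem_singleton, not_or] at hx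
        linarith [tri u v x huv (Ne.symm hx.1) (Ne.symm hx.2),
          ins u x v (Ne.symm hx.1) huv hx.2]
      obtain ⟨-, rfl⟩ := hanti α hs
      exact exists_potential_of_triangle hs tri
    · have ex := fun {u v w x : Fin N} => exchange_of_cycleSum_const (u := u) (v := v) (w := w)
        (x := x) (by omega) (by omega) HP
      have sub_eq : ∀ u u' v w, u ≠ v → u ≠ w → u' ≠ v → u' ≠ w → v ≠ w →
          a u v - a u w = a u' v - a u' w := by
        intro u u' v w huv huw huv' huw' hvw
        obtain ⟨x, hx⟩ := exists_ne_of_card_lt {u, u', v, w}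
          ((Finset.card_le_four).trans_lt (by omega))
        simp only [Finset.mem_insert, Finset.mem_singleton, not_or] at hx
        obtain ⟨hxu, hxu', hxv, hxw⟩ := hx
        linarith [ex huv huw (Ne.symm hxu) hvw (Ne.symm hxv) (Ne.symm hxw),
          ex huv' huw' (Ne.symm hxu') hvw (Ne.symm hxv) (Ne.symm hxw)]
      have sum_eq : ∀ u v w, u ≠ v → u ≠ w → v ≠ w → a u v + a v u = a u w + a w u := by
        intro u v w huv huw hvw
        obtain ⟨x, hx⟩ := exists_ne_of_card_lt {u, v, w}
          ((Finset.card_le_three).trans_lt (by omega))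
        simp only [Finset.mem_insert, Finset.mem_singleton, not_or] at hx
        obtain ⟨hxu, hxv, hxw⟩ := hx
        linarith [sub_eq u x v w huv huw hxv hxw hvw,
          ex hxv hxw hxu hvw (Ne.symm huv) (Ne.symm huw)]
      have hsc : ∃ s, ∀ u v, u ≠ v → a u v + a v u = s := by
        refine ⟨a ⟨0, by omega⟩ ⟨1, by omega⟩ + a ⟨1, by omega⟩ ⟨0, by omega⟩, ?_⟩
        generalize hy : (⟨0, by omega⟩ : Fin N) = y
        generalize hz : (⟨1, by omega⟩ : Fin N) = z
        have hyz : y ≠ z := by rw [← hy, ← hz]; simp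
        have sum_eq' : ∀ u v w, u ≠ v → u ≠ w → a u v + a v u = a u w + a w u := by
          intro u v w huv huw
          by_cases hvw : v = w
          · rw [hvw]
          · exact sum_eq u v w huv huw hvw
        intro u v huv
        by_cases huy : u = y
        · subst huy
          exact sum_eq' u v z huv hyz
        · linarith [sum_eq' u v y huv huy, sum_eq' y u z (Ne.symm huy) hyz]
      obtain ⟨s, hs⟩ := hsc
      obtain ⟨rfl, rfl⟩ := hanti s hs
      refine exists_potential_of_triangle hs fun u v w huv huw hvw => ?_
      obtain ⟨x, hx⟩ := exists_ne_of_card_lt {u, v, w}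
        ((Finset.card_le_three).trans_lt (by omega))
      simp only [Finset.mem_insert, Finset.mem_singleton, not_or] at hx
      obtain ⟨hxu, hxv, hxw⟩ := hx
      linarith [sub_eq u x v w huv huw hxv hxw hvw,
        sub_eq v u w x hvw (Ne.symm hxv) huw (Ne.symm hxu) (Ne.symm hxw),
        sub_eq x v u w hxu hxw (Ne.symm huv) hvw huw,
        hs u v huv, hs u w huw, hs v w hvw, hs x u hxu, hs x v hxv, hs x w hxw]

/-- The linear functional on arc vectors given by the weights `a`. -/
noncomputable def arcPairing (N : ℕ) :
    (Fin N → Fin N → ℝ) →ₗ[ℝ] Module.Dual ℝ (Fin N → Fin N → ℝ) :=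
  LinearMap.mk₂ ℝ (fun a x => ∑ i, ∑ j, a i j * x i j)
    (fun a b x => by simp [add_mul, Finset.sum_add_distrib])
    (fun r a x => by simp [Finset.mul_sum, mul_assoc])
    (fun a x y => by simp [mul_add, Finset.sum_add_distrib])
    (fun r a x => by simp [Finset.mul_sum, mul_left_comm])

lemma arcPairing_apply {N : ℕ} (a x : Fin N → Fin N → ℝ) :
    arcPairing N a x = ∑ i, ∑ j, a i j * x i j := rfl

lemma arcPairing_single {N : ℕ} (a : Fin N → Fin N → ℝ) (i j : Fin N) :
    arcPairing N a (Pi.single i (Pi.single j 1)) = a i j := by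
  rw [arcPairing_apply, Finset.sum_eq_single i, Finset.sum_eq_single j]
  · simp
  · intro b _ hb; simp [hb]
  · simp
  · intro b _ hb; simp [hb]
  · simp

lemma arcPairing_injective (N : ℕ) : Function.Injective (arcPairing N) := fun a b h => by
  ext i j
  rw [← arcPairing_single a, h, arcPairing_single]

lemma arcPairing_surjective (N : ℕ) : Function.Surjective (arcPairing N) :=
  (LinearMap.injective_iff_surjective_of_finrank_eq_finrank
    Subspace.dual_finrank_eq.symm).1 (arcPairing_injective N)

lemma arcPairing_incVec {N k : ℕ} (a : Fin N → Fin N → ℝ) (g : Fin (k + 2) → Fin N)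
    (hg : Function.Injective g) :
    arcPairing N a (incVec (Finset.image (fun i => (g i, g (i + 1))) Finset.univ)) =
      ∑ i, a (g i) (g (i + 1)) := by
  rw [arcPairing_apply, ← Finset.sum_product']
  simp only [incVec, mul_ite, mul_one, mul_zero, Prod.mk.eta]
  rw [← Finset.sum_filter, Finset.univ_product_univ, Finset.filter_univ_mem, Finset.sum_image]
  intro i _ j _ h
  exact hg (Prod.ext_iff.1 h).1

lemma card_cycle {N k : ℕ} (g : Fin (k + 2) → Fin N) (hg : Function.Injective g) :
    (Finset.image (fun i => (g i, g (i + 1))) Finset.univ).card = k + 2 := by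
  rw [Finset.card_image_of_injective _ fun i j h => hg (Prod.ext_iff.1 h).1]
  simp

/-- Arc weights with diagonal `d` and, off the diagonal, differences of the potential that
vanishes at node `0` and is given by `π` elsewhere. -/
noncomputable def potentialWeights (n : ℕ) :
    ((Fin (n + 1) → ℝ) × (Fin n → ℝ)) →ₗ[ℝ] (Fin (n + 1) → Fin (n + 1) → ℝ) where
  toFun z i j := if i = j then z.1 i else
    (Fin.cons 0 z.2 : Fin (n + 1) → ℝ) i - (Fin.cons 0 z.2 : Fin (n + 1) → ℝ) j
  map_add' y z := by
    ext i j
    by_cases h : i = j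
    · simp [h]
    · cases i using Fin.cases <;> cases j using Fin.cases <;> simp [h] <;> ring
  map_smul' r z := by
    ext i j
    by_cases h : i = j
    · simp [h]
    · cases i using Fin.cases <;> cases j using Fin.cases <;> simp [h]; ring

lemma potentialWeights_apply {n : ℕ} (z : (Fin (n + 1) → ℝ) × (Fin n → ℝ)) (i j : Fin (n + 1)) :
    potentialWeights n z i j = if i = j then z.1 i else
      (Fin.cons 0 z.2 : Fin (n + 1) → ℝ) i - (Fin.cons 0 z.2 : Fin (n + 1) → ℝ) j := rfl

lemma potentialWeights_injective (n : ℕ) : Function.Injective (potentialWeights n) := by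
  intro y z h
  refine Prod.ext (funext fun i => ?_) (funext fun i => ?_)
  · simpa [potentialWeights_apply] using congrFun (congrFun h i) i
  · simpa [potentialWeights_apply] using congrFun (congrFun h i.succ) 0

lemma mem_range_potentialWeights {n : ℕ} {a : Fin (n + 1) → Fin (n + 1) → ℝ} :
    a ∈ LinearMap.range (potentialWeights n) ↔
      ∃ π : Fin (n + 1) → ℝ, ∀ i j, i ≠ j → a i j = π i - π j := by
  constructor
  · rintro ⟨z, rfl⟩
    exact ⟨Fin.cons 0 z.2, fun i j hij => by simp [potentialWeights_apply, hij]⟩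
  · rintro ⟨π, hπ⟩
    refine ⟨(fun i => a i i, fun i => π i.succ - π 0), ?_⟩
    ext i j
    rw [potentialWeights_apply]
    split_ifs with h
    · rw [h]
    · rw [hπ i j h]
      cases i using Fin.cases <;> cases j using Fin.cases <;> simp

lemma mem_dualAnnihilator_vectorSpan {V : Type*} [AddCommGroup V] [Module ℝ V] {s : Set V}
    {φ : Module.Dual ℝ V} :
    φ ∈ (vectorSpan ℝ s).dualAnnihilator ↔ ∀ x ∈ s, ∀ y ∈ s, φ x = φ y := by
  rw [Submodule.mem_dualAnnihilator]
  constructor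
  · intro h x hx y hy
    have := h _ (vsub_mem_vectorSpan ℝ hx hy)
    rwa [vsub_eq_sub, map_sub, sub_eq_zero] at this
  · intro h w hw
    have hle : vectorSpan ℝ s ≤ LinearMap.ker φ := by
      rw [vectorSpan, Submodule.span_le]
      rintro _ ⟨x, hx, y, hy, rfl⟩
      simp [h x hx y hy]
    exact hle hw

lemma sum_potential_cycle {V : Type*} {k : ℕ} {a : V → V → ℝ} {π : V → ℝ}
    (h : ∀ i j, i ≠ j → a i j = π i - π j) {g : Fin (k + 2) → V} (hg : Function.Injective g) :
    ∑ i, a (g i) (g (i + 1)) = 0 := by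
  have h1 : ∀ i, a (g i) (g (i + 1)) = π (g i) - π (g (i + 1)) := fun i =>
    h _ _ fun e => by simpa using hg e
  simp only [h1, Finset.sum_sub_distrib]
  rw [Equiv.sum_comp (Equiv.addRight (1 : Fin (k + 2))) (fun i => π (g i)) |> Eq.symm]
  simp

lemma dualAnnihilator_vectorSpan_cyclePolytope {n m : ℕ} (hm : 2 ≤ m) {c : Fin m → ℕ}
    (hmono : StrictMono c) (hc2 : ∀ p, 2 ≤ c p) (hcn : ∀ p, c p ≤ n + 1) :
    (vectorSpan ℝ (cyclePolytope (n + 1) c)).dualAnnihilator =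
      LinearMap.range (arcPairing (n + 1) ∘ₗ potentialWeights n) := by
  rw [cyclePolytope, ← direction_affineSpan, affineSpan_convexHull, direction_affineSpan]
  ext φ
  obtain ⟨a, rfl⟩ := arcPairing_surjective _ φ
  have hr : arcPairing (n + 1) a ∈ LinearMap.range (arcPairing (n + 1) ∘ₗ potentialWeights n) ↔
      a ∈ LinearMap.range (potentialWeights n) := by
    simp [LinearMap.mem_range, (arcPairing_injective (n + 1)).eq_iff]
  rw [hr, mem_range_potentialWeights, mem_dualAnnihilator_vectorSpan]
  constructor
  · intro h
    have hlt : c ⟨0, by omega⟩ < c ⟨1, by omega⟩ := hmono (by simp)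
    obtain ⟨k₀, hk₀⟩ : ∃ k, k + 2 = c ⟨0, by omega⟩ :=
      ⟨c ⟨0, by omega⟩ - 2, by have := hc2 ⟨0, by omega⟩; omega⟩
    have hle : k₀ + 2 ≤ n + 1 := hk₀ ▸ hcn _
    have hmem : ∀ (k : ℕ) (g : Fin (k + 2) → Fin (n + 1)), Function.Injective g →
        (∃ p, k + 2 = c p) →
        incVec (Finset.image (fun i => (g i, g (i + 1))) Finset.univ) ∈
          {x | ∃ C : Finset (Fin (n + 1) × Fin (n + 1)), IsSimpleCycle C ∧
            (∃ p, C.card = c p) ∧ x = incVec C} := by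
      rintro k g hg ⟨p, hp⟩
      exact ⟨_, ⟨k, g, hg, rfl⟩, ⟨p, by rw [card_cycle g hg, hp]⟩, rfl⟩
    have hinj : Function.Injective (Fin.castLE hle) := Fin.castLE_injective hle
    refine exists_potential_of_cycleSum_const (hc2 _) hlt (hcn _)
      (α := ∑ i, a (Fin.castLE hle i) (Fin.castLE hle (i + 1))) fun k g hg hk => ?_
    rw [← arcPairing_incVec a g hg, ← arcPairing_incVec a _ hinj]
    exact h _ (hmem k g hg (hk.elim (⟨_, ·⟩) (⟨_, ·⟩))) _ (hmem k₀ _ hinj ⟨_, hk₀⟩)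
  · rintro ⟨π, hπ⟩
    have h0 : ∀ x ∈ {x | ∃ C : Finset (Fin (n + 1) × Fin (n + 1)), IsSimpleCycle C ∧
        (∃ p, C.card = c p) ∧ x = incVec C}, arcPairing (n + 1) a x = 0 := by
      rintro _ ⟨_, ⟨k, g, hg, rfl⟩, -, rfl⟩
      rw [arcPairing_incVec a g hg, sum_potential_cycle hπ hg]
    intro x hx y hy
    rw [h0 x hx, h0 y hy]

/-- **Theorem 3 (i).** For the complete digraph on `n ≥ 3` nodes and a cardinality
sequence `c` with `m ≥ 2` and `2 ≤ c 0 < ⋯ < c (m-1) ≤ n`, the cardinality constrained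
cycle polytope `P_C^c(D_n)` has dimension `(n-1)²`. -/
theorem dim_cyclePolytope (n m : ℕ) (hn : 3 ≤ n) (hm : 2 ≤ m)
    (c : Fin m → ℕ) (hmono : StrictMono c)
    (hc2 : ∀ p, 2 ≤ c p) (hcn : ∀ p, c p ≤ n) :
    adim (cyclePolytope n c) = (n - 1) ^ 2 := by
  obtain ⟨n, rfl⟩ : ∃ k, n = k + 1 := ⟨n - 1, by omega⟩
  have h := Subspace.finrank_add_finrank_dualAnnihilator_eq
    (vectorSpan ℝ (cyclePolytope (n + 1) c))
  rw [dualAnnihilator_vectorSpan_cyclePolytope hm hmono hc2 hcn,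
    LinearMap.finrank_range_of_inj (f := arcPairing (n + 1) ∘ₗ potentialWeights n)
      ((arcPairing_injective (n + 1)).comp (potentialWeights_injective n))] at h
  simp [Module.finrank_pi_fintype] at h
  simp only [adim, Nat.add_sub_cancel]
  nlinarith
end

section
/- Let D_n = (N, A) be the complete digraph on n ≥ 3 nodes and let c = (c_1,…,c_m) be a cardinality sequence with m ≥ 2 and 2 ≤ c_1 < ⋯ < c_m ≤ n. Then for every node i ∈ N, the degree inequality x(δ^out(i)) ≤ 1 defines a facet of the cardinality constrained cycle polytope P_C^c(D_n). -/
open Finset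

section CycleSums

variable {N : ℕ}

theorem incVec_eq_sum_single (C : Finset (Fin N × Fin N)) :
    incVec C = ∑ e ∈ C, Pi.single e.1 (Pi.single e.2 (1 : ℝ)) := by
  classical
  ext u v
  have h : ∀ e : Fin N × Fin N,
      (Pi.single e.1 (Pi.single e.2 (1 : ℝ)) : Fin N → Fin N → ℝ) u v
        = if (u, v) = e then 1 else 0 := by
    rintro ⟨x, y⟩
    by_cases hx : u = x
    · subst hx
      simp [Pi.single_apply]
    · simp [hx]
  simp only [Finset.sum_apply, h, incVec]
  simp

/-- The coefficient of a linear functional at the arc `(u, v)`. -/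
noncomputable def arcCoeff (g : (Fin N → Fin N → ℝ) →ₗ[ℝ] ℝ) (u v : Fin N) : ℝ :=
  g (Pi.single u (Pi.single v 1))

/-- The arc set of the closed walk `f 0, f 1, …, f (k + 1), f 0`. -/
def cycleArcs {k : ℕ} (f : Fin (k + 2) → Fin N) : Finset (Fin N × Fin N) :=
  Finset.image (fun t : Fin (k + 2) => (f t, f (t + 1))) Finset.univ

theorem cycleArcs_map_injective {k : ℕ} {f : Fin (k + 2) → Fin N}
    (hf : Function.Injective f) :
    Function.Injective fun t : Fin (k + 2) => (f t, f (t + 1)) :=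
  fun _ _ h => hf (congrArg Prod.fst h)

theorem card_cycleArcs {k : ℕ} {f : Fin (k + 2) → Fin N} (hf : Function.Injective f) :
    (cycleArcs f).card = k + 2 := by
  simp [cycleArcs, Finset.card_image_of_injective _ (cycleArcs_map_injective hf)]

theorem map_incVec_cycleArcs (g : (Fin N → Fin N → ℝ) →ₗ[ℝ] ℝ) {k : ℕ}
    {f : Fin (k + 2) → Fin N} (hf : Function.Injective f) :
    g (incVec (cycleArcs f)) = ∑ t, arcCoeff g (f t) (f (t + 1)) := by
  rw [incVec_eq_sum_single, map_sum, cycleArcs,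
    Finset.sum_image ((cycleArcs_map_injective hf).injOn)]
  rfl

/-- `x ↦ x(δ^out(i))` as a linear functional. -/
noncomputable def outSumLinear (i : Fin N) : (Fin N → Fin N → ℝ) →ₗ[ℝ] ℝ where
  toFun x := outSum x i
  map_add' x y := by simp [outSum, Finset.sum_add_distrib]
  map_smul' r x := by simp only [outSum, Pi.smul_apply, smul_eq_mul, Finset.mul_sum,
    RingHom.id_apply]

theorem arcCoeff_outSumLinear (i : Fin N) {u v : Fin N} (huv : u ≠ v) :
    arcCoeff (outSumLinear i) u v = if u = i then 1 else 0 := by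
  change outSum _ i = _
  unfold outSum
  split_ifs with h
  · subst h
    simp [Pi.single_apply, huv.symm]
  · simp [Pi.single_eq_of_ne (Ne.symm h)]

theorem apply_ne_apply_add_one {k : ℕ} {f : Fin (k + 2) → Fin N}
    (hf : Function.Injective f) (t : Fin (k + 2)) : f t ≠ f (t + 1) := by
  intro h
  have := hf h
  simp at this

theorem outSum_cycleArcs (i : Fin N) {k : ℕ} {f : Fin (k + 2) → Fin N}
    (hf : Function.Injective f) :
    outSum (incVec (cycleArcs f)) i = ∑ t, if f t = i then (1 : ℝ) else 0 := by
  change outSumLinear i _ = _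
  rw [map_incVec_cycleArcs _ hf]
  exact Finset.sum_congr rfl fun t _ =>
    arcCoeff_outSumLinear i (apply_ne_apply_add_one hf t)

theorem outSum_cycleArcs_of_apply_eq {i : Fin N} {k : ℕ} {f : Fin (k + 2) → Fin N}
    (hf : Function.Injective f) {s : Fin (k + 2)} (hs : f s = i) :
    outSum (incVec (cycleArcs f)) i = 1 := by
  rw [outSum_cycleArcs i hf]
  subst hs
  simp [hf.eq_iff]

theorem outSum_cycleArcs_of_forall_ne {i : Fin N} {k : ℕ} {f : Fin (k + 2) → Fin N}
    (hf : Function.Injective f) (hs : ∀ s, f s ≠ i) :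
    outSum (incVec (cycleArcs f)) i = 0 := by
  rw [outSum_cycleArcs i hf]
  simp [hs]

theorem outSum_cycleArcs_le_one (i : Fin N) {k : ℕ} {f : Fin (k + 2) → Fin N}
    (hf : Function.Injective f) : outSum (incVec (cycleArcs f)) i ≤ 1 := by
  by_cases h : ∃ s, f s = i
  · obtain ⟨s, hs⟩ := h
    exact (outSum_cycleArcs_of_apply_eq hf hs).le
  · rw [outSum_cycleArcs_of_forall_ne hf (not_exists.mp h)]
    exact zero_le_one

theorem sum_add_one_eq {k : ℕ} (F : Fin (k + 2) → ℝ) : ∑ t, F (t + 1) = ∑ t, F t :=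
  Equiv.sum_comp (Equiv.addRight (1 : Fin (k + 2))) F

end CycleSums

section Paths

variable {N : ℕ} {i : Fin N}

/-- `v 0, …, v (q - 1)` is a simple path on `q` nodes avoiding `i`. -/
def IsPathAvoiding (i : Fin N) (q : ℕ) (v : ℕ → Fin N) : Prop :=
  Set.InjOn v (Set.Iio q) ∧ ∀ t < q, v t ≠ i

theorem exists_isPathAvoiding {ι : Type*} [Finite ι] {q : ℕ} (hq : q < N) {s : ι → ℕ}
    (hs : Function.Injective s) (hsq : ∀ j, s j < q) {x : ι → Fin N}
    (hx : Function.Injective x) (hxi : ∀ j, x j ≠ i) :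
    ∃ v, IsPathAvoiding i q v ∧ ∀ j, v (s j) = x j := by
  have hN : N - 1 < N := by omega
  let S : Option ι → Fin N :=
    fun o => o.elim ⟨N - 1, hN⟩ fun j => ⟨s j, (hsq j).trans hq⟩
  have hS : Function.Injective S := by
    rintro (_ | j) (_ | l) h
    · rfl
    · have := hsq l
      simp [S] at h
      omega
    · have := hsq j
      simp [S] at h
      omega
    · simpa [S, hs.eq_iff] using h
  have hX : Function.Injective fun o : Option ι => o.elim i x := by
    rintro (_ | j) (_ | l) h
    · rfl
    · exact absurd h.symm (hxi l)
    · exact absurd h (hxi j)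
    · exact congrArg some (hx h)
  obtain ⟨σ, hσ⟩ := Equiv.Perm.exists_extending_pair S _ hS hX
  have hlast : σ ⟨N - 1, hN⟩ = i := hσ none
  have hv : ∀ t (ht : t < N), (fun t => if h : t < N then σ ⟨t, h⟩ else i) t = σ ⟨t, ht⟩ :=
    fun t ht => dif_pos ht
  refine ⟨fun t => if h : t < N then σ ⟨t, h⟩ else i, ⟨?_, ?_⟩, ?_⟩
  · intro t ht u hu h
    rw [hv t (ht.trans hq), hv u (hu.trans hq)] at h
    simpa using σ.injective h
  · intro t ht h
    rw [hv t (ht.trans hq), ← hlast] at h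
    have := σ.injective h
    simp at this
    omega
  · intro j
    rw [hv _ ((hsq j).trans hq)]
    exact hσ (some j)

theorem exists_isPathAvoiding_apply {q : ℕ} (hq : q < N) {s : ℕ} (hs : s < q)
    {x : Fin N} (hx : x ≠ i) : ∃ v, IsPathAvoiding i q v ∧ v s = x := by
  obtain ⟨v, hv, h⟩ := exists_isPathAvoiding (ι := Unit) (i := i) hq (s := fun _ => s)
    (Function.injective_of_subsingleton _) (fun _ => hs) (x := fun _ => x)
    (Function.injective_of_subsingleton _) (fun _ => hx)
  exact ⟨v, hv, h ()⟩

theorem exists_isPathAvoiding_zero_one {q : ℕ} (hq : q < N) (h1 : 1 < q) {x y : Fin N}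
    (hx : x ≠ i) (hy : y ≠ i) (hxy : x ≠ y) :
    ∃ v, IsPathAvoiding i q v ∧ v 0 = x ∧ v 1 = y := by
  obtain ⟨v, hv, h⟩ := exists_isPathAvoiding (i := i) hq (s := fun j : Fin 2 => (j : ℕ))
    Fin.val_injective (fun j => by omega) (x := ![x, y])
    (by intro j l; fin_cases j <;> fin_cases l <;> simp [hxy, hxy.symm])
    (by intro j; fin_cases j <;> simp [hx, hy])
  exact ⟨v, hv, h 0, h 1⟩

/-- Cyclically shift the first `d + 1` nodes of a path. -/
def rotatePath (d : ℕ) (v : ℕ → Fin N) (t : ℕ) : Fin N :=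
  if t < d then v (t + 1) else if t = d then v 0 else v t

theorem IsPathAvoiding.rotatePath {q d : ℕ} {v : ℕ → Fin N} (hv : IsPathAvoiding i q v)
    (hd : d < q) : IsPathAvoiding i q (rotatePath d v) := by
  obtain ⟨hinj, hne⟩ := hv
  constructor
  · intro t ht u hu h
    simp only [Set.mem_Iio] at ht hu
    unfold _root_.rotatePath at h
    split_ifs at h <;>
    · have := hinj (by simp only [Set.mem_Iio]; omega) (by simp only [Set.mem_Iio]; omega) h
      omega
  · intro t ht
    unfold _root_.rotatePath
    split_ifs <;> exact hne _ (by omega)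

theorem IsPathAvoiding.shift {r d q : ℕ} {v : ℕ → Fin N} (hv : IsPathAvoiding i q v)
    (hq : d + r ≤ q) : IsPathAvoiding i r fun t => v (d + t) := by
  refine ⟨fun t ht u hu h => ?_, fun t ht => hv.2 _ (by omega)⟩
  simp only [Set.mem_Iio] at ht hu
  have := hv.1 (by simp only [Set.mem_Iio]; omega) (by simp only [Set.mem_Iio]; omega) h
  omega

theorem arc_eq_zero_of_sum_path_eq_zero {a : Fin N → Fin N → ℝ} {d q : ℕ} (hd : 1 ≤ d)
    (hdq : d < q)
    (H : ∀ v, IsPathAvoiding i q v → ∑ t ∈ range d, a (v t) (v (t + 1)) = 0)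
    {v : ℕ → Fin N} (hv : IsPathAvoiding i q v) : a (v 0) (v 1) = 0 := by
  have closing : ∀ v, IsPathAvoiding i q v → a (v d) (v 0) = a (v 0) (v 1) := by
    intro v hv
    obtain ⟨e, rfl⟩ : ∃ e, d = e + 1 := ⟨d - 1, by omega⟩
    have h1 := H v hv
    have h2 := H _ (hv.rotatePath hdq)
    rw [Finset.sum_range_succ'] at h1
    rw [Finset.sum_range_succ] at h2
    have h3 : ∑ t ∈ range e,
        a (rotatePath (e + 1) v t) (rotatePath (e + 1) v (t + 1)) =
        ∑ t ∈ range e, a (v (t + 1)) (v (t + 1 + 1)) := by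
      refine Finset.sum_congr rfl fun t ht => ?_
      have := Finset.mem_range.mp ht
      simp [rotatePath, this, Nat.lt_succ_of_lt this]
    rw [h3] at h2
    simp [rotatePath] at h1 h2
    linarith
  have all : ∀ t, t < d → ∀ v, IsPathAvoiding i q v →
      a (v t) (v (t + 1)) = a (v 0) (v 1) := by
    intro t
    induction t with
    | zero => exact fun _ _ _ => rfl
    | succ t ih =>
      intro ht v hv
      have hr := hv.rotatePath hdq
      have h1 := ih (by omega) _ hr
      have h2 := closing _ hr
      have e0 : rotatePath d v 0 = v 1 := by simp [rotatePath, show 0 < d by omega]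
      have ed : rotatePath d v d = v 0 := by simp [rotatePath]
      have et : rotatePath d v t = v (t + 1) := by simp [rotatePath, show t < d by omega]
      have et' : rotatePath d v (t + 1) = v (t + 1 + 1) := by simp [rotatePath, ht]
      rw [et, et'] at h1
      rw [ed, e0] at h2
      rw [h1, e0, h2]
  have h := H v hv
  rw [Finset.sum_congr rfl fun t ht => all t (Finset.mem_range.mp ht) v hv] at h
  simpa [show d ≠ 0 by omega] using h

theorem arc_eq_zero_and_end_eq_of_sum_path_eq {a : Fin N → Fin N → ℝ} {h : Fin N → ℝ}
    {b : ℝ} {p d : ℕ} (hd : 1 ≤ d) (hN : p + d + 1 < N)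
    (Hp : ∀ v, IsPathAvoiding i (p + 1) v →
      ∑ t ∈ range p, a (v t) (v (t + 1)) + h (v p) = b)
    (Hq : ∀ v, IsPathAvoiding i (p + d + 1) v →
      ∑ t ∈ range (p + d), a (v t) (v (t + 1)) + h (v (p + d)) = b) :
    (∀ u v, u ≠ i → v ≠ i → u ≠ v → a u v = 0) ∧ ∀ x, x ≠ i → h x = b := by
  have hzero : ∀ u v, u ≠ i → v ≠ i → u ≠ v → a u v = 0 := by
    intro x y hx hy hxy
    obtain ⟨v, hv, rfl, rfl⟩ := exists_isPathAvoiding_zero_one hN (by omega) hx hy hxy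
    refine arc_eq_zero_of_sum_path_eq_zero hd (by omega) (fun v hv => ?_) hv
    have h1 := Hq v hv
    have h2 := Hp _ (hv.shift (d := d) (r := p + 1) (by omega))
    rw [add_comm p d, Finset.sum_range_add] at h1
    simp only [← add_assoc] at h2
    linarith
  refine ⟨hzero, fun x hx => ?_⟩
  obtain ⟨v, hv, rfl⟩ := exists_isPathAvoiding_apply (q := p + 1) (by omega)
    (Nat.lt_succ_self p) hx
  rw [← Hp v hv, Finset.sum_eq_zero, zero_add]
  intro t ht
  have ht := Finset.mem_range.mp ht
  refine hzero _ _ (hv.2 _ (by omega)) (hv.2 _ (by omega)) fun he => ?_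
  have := hv.1 (by simp only [Set.mem_Iio]; omega) (by simp only [Set.mem_Iio]; omega) he
  omega

/-- The cycle through `i` that continues along the path `v`. -/
def cycleOfPath (i : Fin N) (k : ℕ) (v : ℕ → Fin N) : Fin (k + 2) → Fin N :=
  Fin.cons i fun t : Fin (k + 1) => v t

theorem cycleOfPath_injective {k : ℕ} {v : ℕ → Fin N} (hv : IsPathAvoiding i (k + 1) v) :
    Function.Injective (cycleOfPath i k v) := by
  refine Fin.cons_injective_iff.mpr ⟨?_, fun t u h => ?_⟩
  · rintro ⟨t, ht⟩
    exact hv.2 t t.2 ht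
  · exact Fin.ext (hv.1 t.2 u.2 h)

theorem sum_cycleOfPath (a : Fin N → Fin N → ℝ) (k : ℕ) (v : ℕ → Fin N) :
    ∑ t, a (cycleOfPath i k v t) (cycleOfPath i k v (t + 1)) =
      a i (v 0) + ∑ t ∈ range k, a (v t) (v (t + 1)) + a (v k) i := by
  rw [Fin.sum_univ_castSucc, Finset.sum_range]
  simp only [Fin.coeSucc_eq_succ, Fin.last_add_one]
  rw [Fin.sum_univ_succ]
  rfl

theorem sum_cycle_eq_of_sum_cycle_through_eq {a : Fin N → Fin N → ℝ} {b : ℝ} {k l : ℕ}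
    (hkl : k < l) (hl : l + 2 ≤ N)
    (Hk : ∀ f : Fin (k + 2) → Fin N, Function.Injective f → f 0 = i →
      ∑ t, a (f t) (f (t + 1)) = b)
    (Hl : ∀ f : Fin (l + 2) → Fin N, Function.Injective f → f 0 = i →
      ∑ t, a (f t) (f (t + 1)) = b)
    {r : ℕ} {f : Fin (r + 2) → Fin N} (hf : Function.Injective f) :
    ∑ t, a (f t) (f (t + 1)) = b * ∑ t, if f t = i then (1 : ℝ) else 0 := by
  obtain ⟨d, rfl⟩ := Nat.exists_eq_add_of_le hkl.le
  set π : Fin N → ℝ := fun u => if u = i then 0 else a i u with hπ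
  set a' : Fin N → Fin N → ℝ := fun u v => a u v + π u - π v with ha'
  have hsum : ∀ {r : ℕ} (f : Fin (r + 2) → Fin N),
      ∑ t, a' (f t) (f (t + 1)) = ∑ t, a (f t) (f (t + 1)) := by
    intro r f
    simp only [ha', Finset.sum_sub_distrib, Finset.sum_add_distrib]
    rw [sum_add_one_eq fun t => π (f t)]
    ring
  have hout : ∀ v, v ≠ i → a' i v = 0 := fun v hv => by simp [ha', hπ, hv]
  have hpath : ∀ k : ℕ, (∀ f : Fin (k + 2) → Fin N, Function.Injective f → f 0 = i →
      ∑ t, a (f t) (f (t + 1)) = b) → ∀ v, IsPathAvoiding i (k + 1) v →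
      ∑ t ∈ range k, a' (v t) (v (t + 1)) + a' (v k) i = b := by
    intro k H v hv
    rw [← H _ (cycleOfPath_injective hv) rfl, ← hsum, sum_cycleOfPath,
      hout _ (hv.2 0 (by omega)), zero_add]
  obtain ⟨hzero, hin⟩ := arc_eq_zero_and_end_eq_of_sum_path_eq (h := fun x => a' x i)
    (by omega) (by omega) (hpath k Hk) (hpath (k + d) Hl)
  have harc : ∀ u v, u ≠ v → a' u v = b * if v = i then 1 else 0 := by
    intro u v huv
    by_cases hv : v = i
    · subst hv
      simpa using hin u huv
    · by_cases hu : u = i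
      · subst hu
        simpa [hv] using hout v hv
      · simpa [hv] using hzero u v hu hv huv
  rw [← hsum, ← sum_add_one_eq fun t => if f t = i then (1 : ℝ) else 0, Finset.mul_sum]
  exact Finset.sum_congr rfl fun t _ => harc _ _ (apply_ne_apply_add_one hf t)

end Paths

section Facet

variable {V : Type*} [AddCommGroup V] [Module ℝ V]

/-- If every functional that is constant on a nonempty face is, on the face's polytope,
a multiple of the functional defining the face, then that face is a facet. -/
theorem adim_face_add_one [FiniteDimensional ℝ V] {P : Set V} (L : V →ₗ[ℝ] ℝ) (b : ℝ)
    (H : ∀ (g : V →ₗ[ℝ] ℝ) (β : ℝ), (∀ x ∈ P, L x = b → g x = β) →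
      ∃ r : ℝ, ∀ x ∈ P, g x = r * L x)
    {x₀ y₀ : V} (hx₀ : x₀ ∈ P) (hx₀' : L x₀ = b) (hy₀ : y₀ ∈ P) (hy₀' : L y₀ ≠ b) :
    adim {x ∈ P | L x = b} + 1 = adim P := by
  set F : Set V := {x ∈ P | L x = b} with hF
  set U := vectorSpan ℝ P
  have hker : (LinearMap.ker (L.domRestrict U)).map U.subtype = vectorSpan ℝ F := by
    apply le_antisymm
    · rintro _ ⟨⟨x, hxU⟩, hx, rfl⟩
      by_contra hxF
      obtain ⟨g, hgx, hg⟩ := Submodule.exists_le_ker_of_notMem hxF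
      obtain ⟨r, hr⟩ := H g (g x₀) fun x hx hxb => by
        have := hg (vsub_mem_vectorSpan ℝ (show x ∈ F from ⟨hx, hxb⟩)
          (show x₀ ∈ F from ⟨hx₀, hx₀'⟩))
        simpa [sub_eq_zero] using this
      have hU : U ≤ LinearMap.ker (g - r • L) := by
        rw [show U = vectorSpan ℝ P from rfl, vectorSpan_def, Submodule.span_le]
        rintro _ ⟨x, hx, y, hy, rfl⟩
        simp [hr x hx, hr y hy]
        ring
      have hgU := hU hxU
      have hLx : L x = 0 := hx
      simp [hLx] at hgU
      exact hgx hgU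
    · rw [vectorSpan_def, Submodule.span_le]
      rintro _ ⟨x, hx, y, hy, rfl⟩
      refine ⟨⟨x -ᵥ y, vsub_mem_vectorSpan ℝ hx.1 hy.1⟩, ?_, rfl⟩
      change L (x - y) = 0
      rw [map_sub, hx.2, hy.2, sub_self]
  have hrange : LinearMap.range (L.domRestrict U) = ⊤ := by
    refine LinearMap.range_eq_top.mpr (LinearMap.surjective fun h0 => hy₀' ?_)
    have h : L (y₀ - x₀) = 0 :=
      LinearMap.congr_fun h0 ⟨y₀ - x₀, vsub_mem_vectorSpan ℝ hy₀ hx₀⟩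
    rwa [map_sub, hx₀', sub_eq_zero] at h
  have hrank := LinearMap.finrank_range_add_finrank_ker (L.domRestrict U)
  rw [hrange, finrank_top, Module.finrank_self] at hrank
  unfold adim
  rw [← hker, Submodule.finrank_map_subtype_eq, add_comm]
  exact hrank

end Facet

/-- **Theorem 3 (ii).** For the complete digraph on `n ≥ 3` nodes and a cardinality
sequence `c` with `m ≥ 2` and `2 ≤ c 0 < ⋯ < c (m-1) ≤ n`, for every node `i` the degree
inequality `x(δ^out(i)) ≤ 1` defines a facet of the cardinality constrained cycle
polytope `P_C^c(D_n)`. -/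
theorem degree_facet_cyclePolytope (n m : ℕ) (hn : 3 ≤ n) (hm : 2 ≤ m)
    (c : Fin m → ℕ) (hmono : StrictMono c)
    (hc2 : ∀ p, 2 ≤ c p) (hcn : ∀ p, c p ≤ n) (i : Fin n) :
    IsFacetLE (cyclePolytope n c) (fun x => outSum x i) 1 := by
  set P := cyclePolytope n c
  have hvertex : ∀ {k : ℕ} {f : Fin (k + 2) → Fin n}, Function.Injective f →
      (∃ p, k + 2 = c p) → incVec (cycleArcs f) ∈ P := by
    rintro k f hf ⟨p, hp⟩
    exact subset_convexHull ℝ _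
      ⟨_, ⟨k, f, hf, rfl⟩, ⟨p, (card_cycleArcs hf).trans hp⟩, rfl⟩
  have hP : ∀ K : Set (Fin n → Fin n → ℝ), Convex ℝ K →
      (∀ (k : ℕ) (f : Fin (k + 2) → Fin n), Function.Injective f →
        incVec (cycleArcs f) ∈ K) → P ⊆ K := by
    intro K hK h
    refine convexHull_min ?_ hK
    rintro _ ⟨_, ⟨k, f, hf, rfl⟩, -, rfl⟩
    exact h k f hf
  obtain ⟨k, hk⟩ : ∃ k, k + 2 = c ⟨0, by omega⟩ := ⟨_, Nat.sub_add_cancel (hc2 _)⟩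
  obtain ⟨l, hl⟩ : ∃ l, l + 2 = c ⟨1, by omega⟩ := ⟨_, Nat.sub_add_cancel (hc2 _)⟩
  have hkl : k < l := by
    have := hmono (show (⟨0, by omega⟩ : Fin m) < ⟨1, by omega⟩ by simp)
    omega
  have hln : l + 2 ≤ n := hl ▸ hcn _
  obtain ⟨j, hj⟩ : ∃ j, j ≠ i :=
    haveI : Nontrivial (Fin n) := Fin.nontrivial_iff_two_le.mpr (by omega)
    exists_ne i
  refine ⟨hP _ (convex_halfSpace_le (outSumLinear i).isLinear 1)
    fun k f hf => outSum_cycleArcs_le_one i hf, ?_⟩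
  obtain ⟨v, hv, -⟩ := exists_isPathAvoiding_apply (q := k + 1) (s := 0) (by omega)
    (by omega) hj
  obtain ⟨w, hw, -⟩ := exists_isPathAvoiding_apply (q := k + 2) (s := 0) (by omega)
    (by omega) hj
  have hw' : Function.Injective fun t : Fin (k + 2) => w t :=
    fun t u h => Fin.ext (hw.1 t.2 u.2 h)
  refine adim_face_add_one (outSumLinear i) 1 ?_
    (hvertex (cycleOfPath_injective hv) ⟨_, hk⟩)
    (outSum_cycleArcs_of_apply_eq (s := 0) (cycleOfPath_injective hv) rfl)
    (hvertex hw' ⟨_, hk⟩)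
    ((outSum_cycleArcs_of_forall_ne hw' fun t => hw.2 t t.2).trans_ne zero_ne_one)
  intro g β hg
  have hthrough : ∀ r, (∃ p, r + 2 = c p) → ∀ f : Fin (r + 2) → Fin n,
      Function.Injective f → f 0 = i → ∑ t, arcCoeff g (f t) (f (t + 1)) = β := by
    intro r hr f hf h0
    rw [← map_incVec_cycleArcs g hf]
    exact hg _ (hvertex hf hr) (outSum_cycleArcs_of_apply_eq hf h0)
  refine ⟨β, fun x hx => sub_eq_zero.mp ?_⟩
  refine hP (LinearMap.ker (g - β • outSumLinear i) : Submodule ℝ _)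
    (Submodule.convex _) (fun r f hf => sub_eq_zero.mpr ?_) hx
  rw [map_incVec_cycleArcs g hf, sum_cycle_eq_of_sum_cycle_through_eq hkl hln
    (hthrough k ⟨_, hk⟩) (hthrough l ⟨_, hl⟩) hf, ← outSum_cycleArcs i hf]
  rfl
end

section
/- Let D = (N, A) be a digraph without loops and parallel arcs, n = |N|, and let c = (c_1,…,c_m) be a cardinality sequence with 2 ≤ c_1 < ⋯ < c_m ≤ n. A vector x ∈ {0,1}^A is the incidence vector of a simple directed cycle C with |C| = c_p for some p ∈ {1,…,m} if and only if x satisfies all of: (1) x(δ^out(i)) − x(δ^in(i)) = 0 for all i ∈ N; (2) x(δ^out(i)) ≤ 1 for all i ∈ N; (3) −x((S : N∖S)) + x(δ^out(i)) + x(δ^out(j)) ≤ 1 for all S ⊂ N with 2 ≤ |S| ≤ n−2 and all i ∈ S, j ∈ N∖S; (4) c_1 ≤ x(A) ≤ c_m; (5) (c_{p+1} − |W|)·Σ_{i∈W} x(δ^out(i)) − (|W| − c_p)·Σ_{i∈N∖W} x(δ^out(i)) ≤ c_p·(c_{p+1} − |W|) for all W ⊆ N such that c_p < |W| < c_{p+1}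 for some p ∈ {1,…,m−1}. -/
open Finset

/-- The non-loop arcs `i → σ i` of a permutation `σ`. -/
def permArcs {N : ℕ} (σ : Equiv.Perm (Fin N)) : Finset (Fin N × Fin N) :=
  σ.support.image fun i => (i, σ i)

lemma mem_permArcs {N : ℕ} {σ : Equiv.Perm (Fin N)} {i j : Fin N} :
    (i, j) ∈ permArcs σ ↔ σ i = j ∧ i ∈ σ.support := by
  unfold permArcs
  rw [mem_image]
  constructor
  · rintro ⟨k, hk, h⟩
    obtain ⟨rfl, rfl⟩ := Prod.mk.inj h
    exact ⟨rfl, hk⟩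
  · rintro ⟨rfl, h⟩
    exact ⟨i, h, rfl⟩

lemma card_permArcs {N : ℕ} (σ : Equiv.Perm (Fin N)) : (permArcs σ).card = σ.support.card :=
  card_image_of_injective _ fun _ _ h => (Prod.mk.inj h).1

lemma IsSimpleCycle.exists_perm {N : ℕ} {C : Finset (Fin N × Fin N)} (hC : IsSimpleCycle C) :
    ∃ σ : Equiv.Perm (Fin N), σ.IsCycle ∧ C = permArcs σ := by
  classical
  obtain ⟨k, f, hf, rfl⟩ := hC
  let e : Fin (k + 2) ≃ {y // y ∈ Set.range f} := Equiv.ofInjective f hf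
  have hσ : ∀ i, (finRotate (k + 2)).extendDomain e (f i) = f (i + 1) := fun i => by
    have := Equiv.Perm.extendDomain_apply_image (finRotate (k + 2)) e i
    rwa [finRotate_apply] at this
  refine ⟨(finRotate (k + 2)).extendDomain e, isCycle_finRotate.extendDomain e, ?_⟩
  ext ⟨i, j⟩
  rw [mem_permArcs, mem_image, Equiv.Perm.mem_support]
  constructor
  · rintro ⟨t, -, h⟩
    obtain ⟨rfl, rfl⟩ := Prod.mk.inj h
    refine ⟨hσ t, ?_⟩
    rw [hσ]
    intro h
    simpa using hf h
  · rintro ⟨rfl, h⟩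
    by_cases hi : i ∈ Set.range f
    · obtain ⟨t, rfl⟩ := hi
      exact ⟨t, mem_univ _, by rw [hσ]⟩
    · exact absurd (Equiv.Perm.extendDomain_apply_not_subtype _ e hi) h

lemma Equiv.Perm.IsCycle.isSimpleCycle_permArcs {N : ℕ} {σ : Equiv.Perm (Fin N)}
    (hσ : σ.IsCycle) : IsSimpleCycle (permArcs σ) := by
  obtain ⟨k, hk⟩ := Nat.exists_eq_add_of_le' hσ.two_le_card_support
  obtain ⟨a, ha, -⟩ := id hσ
  have hord : orderOf σ = k + 2 := by rw [hσ.orderOf, hk]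
  have hinj : Function.Injective fun i : Fin (k + 2) => (σ ^ (i : ℕ)) a := by
    intro i j h
    have h1 : σ ^ (i : ℕ) = σ ^ (j : ℕ) := hσ.pow_eq_pow_iff.2 ⟨a, ha, h⟩
    exact Fin.ext (pow_injOn_Iio_orderOf (by simp [hord]) (by simp [hord]) h1)
  have hsucc : ∀ i : Fin (k + 2), (σ ^ ((i + 1 : Fin (k + 2)) : ℕ)) a = σ ((σ ^ (i : ℕ)) a) := by
    intro i
    have hmod : ((i + 1 : Fin (k + 2)) : ℕ) ≡ i + 1 [MOD orderOf σ] := by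
      rw [hord, Fin.val_add]
      simpa using Nat.mod_modEq _ _
    rw [← Equiv.Perm.mul_apply, ← pow_succ', pow_eq_pow_iff_modEq.2 hmod]
  refine ⟨k, fun i => (σ ^ (i : ℕ)) a, hinj, ?_⟩
  symm
  apply eq_of_subset_of_card_le
  · intro p hp
    obtain ⟨i, -, rfl⟩ := mem_image.1 hp
    rw [mem_permArcs]
    refine ⟨(hsucc i).symm, ?_⟩
    rw [Equiv.Perm.pow_apply_mem_support, Equiv.Perm.mem_support]
    exact ha
  · rw [card_permArcs, hk, card_image_of_injective _ fun _ _ h => hinj (Prod.mk.inj h).1]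
    simp

lemma sum_incVec_permArcs {N : ℕ} {A : Finset (Fin N × Fin N)} {x : Fin N → Fin N → ℝ}
    (hsupp : ∀ a : Fin N × Fin N, a ∉ A → x a.1 a.2 = 0) {σ : Equiv.Perm (Fin N)}
    (hx : ∀ i j, x i j = incVec (permArcs σ) i j) (P : Fin N × Fin N → Prop) [DecidablePred P] :
    ∑ a ∈ A.filter P, x a.1 a.2 = ((σ.support.filter fun i => P (i, σ i)).card : ℝ) := by
  have h1 : ∑ a ∈ A.filter P, x a.1 a.2 = ∑ a ∈ univ.filter P, x a.1 a.2 := by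
    apply sum_subset (filter_subset_filter _ (subset_univ _))
    intro a ha ha'
    apply hsupp
    intro h
    exact ha' (mem_filter.2 ⟨h, (mem_filter.1 ha).2⟩)
  have h2 : ∑ a ∈ univ.filter P, x a.1 a.2 = (((permArcs σ).filter P).card : ℝ) := by
    simp only [hx, incVec, Prod.mk.eta]
    rw [sum_boole]
    congr 2
    ext a
    simp [and_comm]
  rw [h1, h2, permArcs, filter_image,
    card_image_of_injective _ fun _ _ h => (Prod.mk.inj h).1]

lemma sum_out_permArcs {N : ℕ} {A : Finset (Fin N × Fin N)} {x : Fin N → Fin N → ℝ}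
    (hsupp : ∀ a : Fin N × Fin N, a ∉ A → x a.1 a.2 = 0) {σ : Equiv.Perm (Fin N)}
    (hx : ∀ i j, x i j = incVec (permArcs σ) i j) (i : Fin N) :
    ∑ a ∈ A.filter (fun a => a.1 = i), x a.1 a.2 = if i ∈ σ.support then 1 else 0 := by
  rw [sum_incVec_permArcs hsupp hx, filter_eq']
  split_ifs <;> simp

lemma sum_in_permArcs {N : ℕ} {A : Finset (Fin N × Fin N)} {x : Fin N → Fin N → ℝ}
    (hsupp : ∀ a : Fin N × Fin N, a ∉ A → x a.1 a.2 = 0) {σ : Equiv.Perm (Fin N)}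
    (hx : ∀ i j, x i j = incVec (permArcs σ) i j) (i : Fin N) :
    ∑ a ∈ A.filter (fun a => a.2 = i), x a.1 a.2 = if i ∈ σ.support then 1 else 0 := by
  have h : (σ.support.filter fun j => σ j = i) = σ.support.filter fun j => j = σ⁻¹ i := by
    simp only [Equiv.Perm.eq_inv_iff_eq]
  have h' : σ⁻¹ i ∈ σ.support ↔ i ∈ σ.support := by
    rw [← Equiv.Perm.apply_mem_support, Equiv.Perm.coe_inv, Equiv.apply_symm_apply]
  rw [sum_incVec_permArcs hsupp hx, h, filter_eq']
  simp only [h']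
  split_ifs <;> simp

lemma sum_all_permArcs {N : ℕ} {A : Finset (Fin N × Fin N)} {x : Fin N → Fin N → ℝ}
    (hsupp : ∀ a : Fin N × Fin N, a ∉ A → x a.1 a.2 = 0) {σ : Equiv.Perm (Fin N)}
    (hx : ∀ i j, x i j = incVec (permArcs σ) i j) :
    ∑ a ∈ A, x a.1 a.2 = (σ.support.card : ℝ) := by
  simpa using sum_incVec_permArcs hsupp hx fun _ => True

lemma Equiv.Perm.IsCycle.exists_exit {N : ℕ} {σ : Equiv.Perm (Fin N)} (hσ : σ.IsCycle)
    {S : Finset (Fin N)} {i j : Fin N} (hi : i ∈ σ.support) (hj : j ∈ σ.support)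
    (hiS : i ∈ S) (hjS : j ∉ S) : ∃ k ∈ σ.support, k ∈ S ∧ σ k ∉ S := by
  by_contra! h
  obtain ⟨t, rfl⟩ := hσ.exists_pow_eq (Equiv.Perm.mem_support.1 hi) (Equiv.Perm.mem_support.1 hj)
  have : ∀ t : ℕ, (σ ^ t) i ∈ S := by
    intro t
    induction t with
    | zero => simpa
    | succ t ih =>
      rw [pow_succ', Equiv.Perm.mul_apply]
      exact h _ (Equiv.Perm.pow_apply_mem_support.2 hi) ih
  exact hjS (this t)

/-- A loopless `0/1`-circulation with out-degrees at most one is the arc set of a permutation. -/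
lemma exists_perm_of_circulation {N : ℕ} {A : Finset (Fin N × Fin N)} (hA : ∀ a ∈ A, a.1 ≠ a.2)
    {x : Fin N → Fin N → ℝ} (h01 : ∀ a ∈ A, x a.1 a.2 = 0 ∨ x a.1 a.2 = 1)
    (hsupp : ∀ a : Fin N × Fin N, a ∉ A → x a.1 a.2 = 0)
    (hflow : ∀ i : Fin N, (∑ a ∈ A.filter (fun a => a.1 = i), x a.1 a.2)
      - (∑ a ∈ A.filter (fun a => a.2 = i), x a.1 a.2) = 0)
    (hdeg : ∀ i : Fin N, (∑ a ∈ A.filter (fun a => a.1 = i), x a.1 a.2) ≤ 1) :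
    ∃ σ : Equiv.Perm (Fin N), ∀ i j, x i j = incVec (permArcs σ) i j := by
  classical
  have h01' : ∀ i j, x i j = 0 ∨ x i j = 1 := fun i j =>
    if h : (i, j) ∈ A then h01 _ h else Or.inl (hsupp (i, j) h)
  have hnn : ∀ i j, 0 ≤ x i j := fun i j => by rcases h01' i j with h | h <;> simp [h]
  have hmem : ∀ {i j}, x i j = 1 → (i, j) ∈ A := fun {i j} h => by
    by_contra h'
    linarith [hsupp (i, j) h']
  have huniq : ∀ (P : Fin N × Fin N → Prop) [DecidablePred P], ∑ a ∈ A.filter P, x a.1 a.2 ≤ 1 →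
      ∀ a b, P a → P b → x a.1 a.2 = 1 → x b.1 b.2 = 1 → a = b := by
    intro P _ hP a b ha hb hxa hxb
    by_contra hab
    have hsub : ({a, b} : Finset _) ⊆ A.filter P := by
      intro c hc
      rcases mem_insert.1 hc with rfl | hc
      · exact mem_filter.2 ⟨hmem hxa, ha⟩
      · rw [mem_singleton.1 hc]
        exact mem_filter.2 ⟨hmem hxb, hb⟩
    have := sum_le_sum_of_subset_of_nonneg (f := fun a => x a.1 a.2) hsub
      fun c _ _ => hnn c.1 c.2
    rw [sum_pair hab] at this
    linarith
  have hnext : ∀ {i j}, x i j = 1 → ∃ k, x j k = 1 := by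
    intro i j hij
    by_contra! h
    have h0 : ∑ a ∈ A.filter (fun a => a.1 = j), x a.1 a.2 = 0 :=
      sum_eq_zero fun a ha => by
        rw [(mem_filter.1 ha).2]
        exact (h01' _ _).resolve_right (h _)
    have h1 := single_le_sum (f := fun a : Fin N × Fin N => x a.1 a.2)
      (fun a _ => hnn a.1 a.2) (mem_filter.2 ⟨hmem hij, rfl⟩ : (i, j) ∈ A.filter fun a => a.2 = j)
    have := hflow j
    simp only [hij] at h1
    linarith
  let g : Fin N → Fin N := fun i => if h : ∃ j, x i j = 1 then h.choose else i
  have hg1 : ∀ {i}, (∃ j, x i j = 1) → x i (g i) = 1 := fun {i} h => by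
    simp only [g, dif_pos h]
    exact h.choose_spec
  have hg0 : ∀ {i}, ¬ (∃ j, x i j = 1) → g i = i := fun {i} h => by
    simp only [g, dif_neg h]
  have hginj : Function.Injective g := by
    intro i j hij
    by_cases hi : ∃ k, x i k = 1 <;> by_cases hj : ∃ k, x j k = 1
    · have h := huniq (fun a => a.2 = g i) (by linarith [hflow (g i), hdeg (g i)])
        (i, g i) (j, g j) rfl hij.symm (hg1 hi) (hg1 hj)
      exact (Prod.mk.inj h).1
    · rw [hg0 hj] at hij
      exact absurd (hnext (hg1 hi)) (hij ▸ hj)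
    · rw [hg0 hi] at hij
      exact absurd (hnext (hg1 hj)) (hij ▸ hi)
    · rwa [hg0 hi, hg0 hj] at hij
  refine ⟨Equiv.ofBijective g (Finite.injective_iff_bijective.1 hginj), fun i j => ?_⟩
  have key : (i, j) ∈ permArcs (Equiv.ofBijective g (Finite.injective_iff_bijective.1 hginj)) ↔
      x i j = 1 := by
    rw [mem_permArcs, Equiv.Perm.mem_support, Equiv.ofBijective_apply]
    constructor
    · rintro ⟨rfl, h⟩
      by_contra h'
      exact h (hg0 fun h'' => h' (hg1 h''))
    · intro h
      have hgi := hg1 ⟨j, h⟩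
      refine ⟨?_, fun h' => hA _ (hmem hgi) h'.symm⟩
      exact (Prod.mk.inj (huniq (fun a => a.1 = i) (hdeg i) (i, g i) (i, j) rfl rfl hgi h)).2
  unfold incVec
  rcases h01' i j with h | h <;> simp [key, h]

/-- If every invariant vertex set separating two moved points is too small or too large,
then the permutation is a cycle. -/
lemma isCycle_of_cut {N : ℕ} {σ : Equiv.Perm (Fin N)} (hne : σ.support.Nonempty)
    (hcut : ∀ S : Finset (Fin N), 2 ≤ S.card → S.card ≤ N - 2 → (∀ k ∈ S, σ k ∈ S) →
      ∀ i ∈ S, ∀ j ∉ S, i ∈ σ.support → j ∉ σ.support) : σ.IsCycle := by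
  classical
  obtain ⟨a, ha⟩ := hne
  refine ⟨a, Equiv.Perm.mem_support.1 ha, fun b hb => ?_⟩
  by_contra hab
  let S : Finset (Fin N) := univ.filter fun i => σ.SameCycle a i
  have hS : ∀ i, i ∈ S ↔ σ.SameCycle a i := by simp [S]
  have hinv : ∀ k, σ k ∈ S ↔ k ∈ S := fun k => by
    rw [hS, hS, Equiv.Perm.sameCycle_apply_right]
  have haS : a ∈ S := (hS a).2 (Equiv.Perm.SameCycle.refl _ _)
  have hbS : b ∉ S := fun h => hab ((hS b).1 h)
  have h1 : 2 ≤ S.card := by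
    apply one_lt_card.2
    exact ⟨σ a, (hinv a).2 haS, a, haS, Equiv.Perm.mem_support.1 ha⟩
  have h2 : 1 < Sᶜ.card := one_lt_card.2
    ⟨σ b, mem_compl.2 fun h => hbS ((hinv b).1 h), b, mem_compl.2 hbS, hb⟩
  have h3 := S.card_add_card_compl
  rw [Fintype.card_fin] at h3
  exact hcut S h1 (by omega) (fun k hk => (hinv k).2 hk) a haS b hbS ha
    (Equiv.Perm.mem_support.2 hb)

/-- A value between the extremes of a finite sequence is attained or lies strictly between two
consecutive terms. -/
lemma exists_eq_or_exists_consecutive {m : ℕ} (hm : 0 < m) (hm' : m - 1 < m) (c : Fin m → ℕ) {k : ℕ}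
    (h0 : c ⟨0, hm⟩ ≤ k) (h1 : k ≤ c ⟨m - 1, hm'⟩) :
    (∃ p, k = c p) ∨ ∃ p q : Fin m, (q : ℕ) = p + 1 ∧ c p < k ∧ k < c q := by
  by_contra! h
  obtain ⟨hne, hstep⟩ := h
  have : ∀ t (ht : t < m), c ⟨t, ht⟩ < k := by
    intro t
    induction t with
    | zero => exact fun _ => lt_of_le_of_ne h0 (hne _).symm
    | succ t ih =>
      intro ht
      exact lt_of_le_of_ne (hstep ⟨t, by omega⟩ ⟨t + 1, ht⟩ rfl (ih _)) (hne _).symm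
  exact absurd (this (m - 1) hm') h1.not_gt

/-- **IP characterization of cardinality constrained cycles (model (3)).**  Let
`D = (Fin n, A)` be a loopless digraph and `c` a cardinality sequence with
`2 ≤ c 0 < ⋯ < c (m-1) ≤ n`.  A `0/1`-vector `x` supported on `A` is the incidence
vector of a simple directed cycle of cardinality `c p` for some `p` if and only if it
satisfies the flow conservation constraints, the degree constraints, the cycle
inequalities, the cardinality bounds, and the cardinality forcing inequalities. -/
theorem cycle_IP_characterization
    (n : ℕ) (A : Finset (Fin n × Fin n)) (hA : ∀ a ∈ A, a.1 ≠ a.2)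
    (m : ℕ) (hm : 1 ≤ m) (c : Fin m → ℕ) (hmono : StrictMono c)
    (hc2 : ∀ p, 2 ≤ c p) (hcn : ∀ p, c p ≤ n)
    (x : Fin n → Fin n → ℝ)
    (h01 : ∀ a ∈ A, x a.1 a.2 = 0 ∨ x a.1 a.2 = 1)
    (hsupp : ∀ a : Fin n × Fin n, a ∉ A → x a.1 a.2 = 0) :
    (∃ C : Finset (Fin n × Fin n), C ⊆ A ∧ IsSimpleCycle C ∧ (∃ p, C.card = c p) ∧
        ∀ i j, x i j = incVec C i j) ↔
      ((∀ i : Fin n, (∑ a ∈ A.filter (fun a => a.1 = i), x a.1 a.2)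
            - (∑ a ∈ A.filter (fun a => a.2 = i), x a.1 a.2) = 0) ∧
       (∀ i : Fin n, (∑ a ∈ A.filter (fun a => a.1 = i), x a.1 a.2) ≤ 1) ∧
       (∀ S : Finset (Fin n), 2 ≤ S.card → S.card ≤ n - 2 →
          ∀ i ∈ S, ∀ j ∈ Finset.univ \ S,
          - (∑ a ∈ A.filter (fun a => a.1 ∈ S ∧ a.2 ∉ S), x a.1 a.2)
            + (∑ a ∈ A.filter (fun a => a.1 = i), x a.1 a.2)
            + (∑ a ∈ A.filter (fun a => a.1 = j), x a.1 a.2) ≤ 1) ∧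
       ((c ⟨0, by omega⟩ : ℝ) ≤ ∑ a ∈ A, x a.1 a.2) ∧
       ((∑ a ∈ A, x a.1 a.2) ≤ (c ⟨m - 1, by omega⟩ : ℝ)) ∧
       (∀ W : Finset (Fin n), ∀ p q : Fin m, (q : ℕ) = (p : ℕ) + 1 →
          c p < W.card → W.card < c q →
          ((c q : ℝ) - W.card) *
              (∑ i ∈ W, ∑ a ∈ A.filter (fun a => a.1 = i), x a.1 a.2)
            - ((W.card : ℝ) - c p) *
                (∑ i ∈ Finset.univ \ W, ∑ a ∈ A.filter (fun a => a.1 = i), x a.1 a.2)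
            ≤ (c p : ℝ) * ((c q : ℝ) - W.card))) := by
  constructor
  · rintro ⟨C, -, hC, ⟨r, hr⟩, hx⟩
    obtain ⟨σ, hσ, rfl⟩ := hC.exists_perm
    rw [card_permArcs] at hr
    simp only [sum_out_permArcs hsupp hx, sum_in_permArcs hsupp hx, sum_all_permArcs hsupp hx, hr]
    refine ⟨fun _ => sub_self _, fun i => by split_ifs <;> norm_num, ?_, ?_, ?_, ?_⟩
    · intro S _ _ i hi j hj
      have hj' : j ∉ S := (mem_sdiff.1 hj).2
      rw [sum_incVec_permArcs hsupp hx]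
      by_cases h : i ∈ σ.support ∧ j ∈ σ.support
      · obtain ⟨k, hk, hkS⟩ := hσ.exists_exit h.1 h.2 hi hj'
        have : 1 ≤ (σ.support.filter fun i => i ∈ S ∧ σ i ∉ S).card :=
          card_pos.2 ⟨k, mem_filter.2 ⟨hk, hkS⟩⟩
        have : (1 : ℝ) ≤ (σ.support.filter fun i => i ∈ S ∧ σ i ∉ S).card := by exact_mod_cast this
        rw [if_pos h.1, if_pos h.2]
        linarith
      · have : (0 : ℝ) ≤ (σ.support.filter fun i => i ∈ S ∧ σ i ∉ S).card := Nat.cast_nonneg _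
        by_cases h1 : i ∈ σ.support
        · rw [if_pos h1, if_neg fun h2 => h ⟨h1, h2⟩]
          linarith
        · rw [if_neg h1]
          split_ifs <;> linarith
    · exact_mod_cast hmono.monotone (Nat.zero_le r : (⟨0, by omega⟩ : Fin m) ≤ r)
    · exact_mod_cast hmono.monotone (Nat.le_sub_one_of_lt r.2 : r ≤ (⟨m - 1, by omega⟩ : Fin m))
    · intro W p q hpq hpW hWq
      rw [sum_boole, sum_boole]
      have hsplit : (W.filter (· ∈ σ.support)).card
          + ((univ \ W).filter (· ∈ σ.support)).card = c r := by
        rw [← card_union_of_disjoint (disjoint_filter_filter disjoint_sdiff), ← filter_union,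
          union_sdiff_of_subset (subset_univ W), ← hr, filter_univ_mem]
      have haW : (W.filter (· ∈ σ.support)).card ≤ W.card := card_filter_le _ _
      have hrpq : c r ≤ c p ∨ c q ≤ c r := by
        rcases le_or_gt r p with h | h
        · exact Or.inl (hmono.monotone h)
        · refine Or.inr (hmono.monotone ?_)
          rw [Fin.le_def, hpq]
          exact h
      generalize (W.filter (· ∈ σ.support)).card = a at *
      generalize ((univ \ W).filter (· ∈ σ.support)).card = b at *
      have h1 : (c p : ℝ) < W.card := by exact_mod_cast hpW
      have h2 : (W.card : ℝ) < c q := by exact_mod_cast hWq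
      have h3 : (a : ℝ) ≤ W.card := by exact_mod_cast haW
      have hb : (0 : ℝ) ≤ b := Nat.cast_nonneg b
      rcases hrpq with h | h
      · have h4 : (a : ℝ) ≤ c p := by exact_mod_cast (by omega : a ≤ c p)
        nlinarith [mul_nonneg (sub_nonneg.2 h1.le) hb,
          mul_nonneg (sub_nonneg.2 h2.le) (sub_nonneg.2 h4)]
      · have h4 : (c q : ℝ) ≤ a + b := by exact_mod_cast (by omega : c q ≤ a + b)
        nlinarith [mul_nonneg (sub_nonneg.2 h1.le) (sub_nonneg.2 h4),
          mul_nonneg (sub_nonneg.2 (h1.trans h2).le) (sub_nonneg.2 h3)]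
  · rintro ⟨hflow, hdeg, hcut, hlo, hhi, hforce⟩
    obtain ⟨σ, hx⟩ := exists_perm_of_circulation hA h01 hsupp hflow hdeg
    simp only [sum_out_permArcs hsupp hx, sum_all_permArcs hsupp hx] at hcut hlo hhi hforce
    have hlo' : c ⟨0, by omega⟩ ≤ σ.support.card := by exact_mod_cast hlo
    have hhi' : σ.support.card ≤ c ⟨m - 1, by omega⟩ := by exact_mod_cast hhi
    have hne : σ.support.Nonempty := card_pos.1 (by have := hc2 ⟨0, by omega⟩; omega)
    have hσ : σ.IsCycle := by
      refine isCycle_of_cut hne fun S hS2 hSn hinv i hi j hj his hjs => ?_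
      have h := hcut S hS2 hSn i hi j (mem_sdiff.2 ⟨mem_univ _, hj⟩)
      have h0 : (σ.support.filter fun i => i ∈ S ∧ σ i ∉ S) = ∅ :=
        filter_eq_empty_iff.2 fun k _ hk => hk.2 (hinv k hk.1)
      rw [sum_incVec_permArcs hsupp hx, h0, if_pos his, if_pos hjs] at h
      norm_num at h
    refine ⟨permArcs σ, fun a ha => ?_, hσ.isSimpleCycle_permArcs, ?_, hx⟩
    · by_contra h
      have h1 := hsupp a h
      rw [hx, incVec, if_pos ha] at h1
      exact one_ne_zero h1
    · rw [card_permArcs]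
      rcases exists_eq_or_exists_consecutive hm (Nat.sub_lt hm one_pos) c hlo' hhi' with h | ⟨p, q, hpq, hp, hq⟩
      · exact h
      · exfalso
        have h := hforce σ.support p q hpq hp hq
        have h1 : (c p : ℝ) < σ.support.card := by exact_mod_cast hp
        have h2 : (σ.support.card : ℝ) < c q := by exact_mod_cast hq
        rw [sum_congr rfl fun i hi => if_pos hi,
          sum_congr (s₁ := univ \ σ.support) rfl fun i hi => if_neg (mem_sdiff.1 hi).2] at h
        simp only [sum_const, nsmul_eq_mul, mul_one, mul_zero, sub_zero] at h
        nlinarith [mul_pos (sub_pos.2 h1) (sub_pos.2 h2)]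
end

section
/- Let c = (c_1,…,c_m) be a cardinality sequence with 2 ≤ c_1 < ⋯ < c_m ≤ n. A vector x ∈ {0,1}^{Ã_n} is the incidence vector of a simple directed (0,n)-path P in D̃_n with |P| = c_p for some p ∈ {1,…,m} if and only if x satisfies all of: (1) x(δ^out(i)) − x(δ^in(i)) equals 1 for i = 0, equals 0 for i ∈ Ñ_n ∖ {0,n}, and equals −1 for i = n; (2) x(δ^out(i)) ≤ 1 for all i ∈ Ñ_n ∖ {0,n}; (3) x((S : Ñ_n∖S)) − x(δ^in(j)) ≥ 0 for all S ⊂ Ñ_n with 0, n ∈ S and all j ∈ Ñ_n ∖ S; (4) c_1 ≤ x(Ã_n) ≤ c_m; (5) (c_{p+1} − |W| + 1)·Σ_{i∈W} x(δ^out(i)) − (|W| − 1 − c_p)·Σ_{i∈Ñ_n∖W} x(δ^out(i)) ≤ c_p·(c_{p+1} − |W| + 1) for all W ⊆ Ñ_n with 0, n ∈ W such that c_p < |W| − 1 < c_{p+1} for some p ∈ {1,…,m−1}. -/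
open Finset

/-- The arc set `Ã_n` of the digraph `D̃_n` on the node set `Ñ_n = {0,1,…,n} = Fin (n+1)`:
all arcs `(i,j)` with `i ≠ j`, except those entering `0`, those leaving `n`, and the arc
`(0,n)`.  This is exactly
`{(0,i),(i,n) : 1 ≤ i ≤ n-1} ∪ {(i,j) : 1 ≤ i,j ≤ n-1, i ≠ j}`. -/
def tA (n : ℕ) : Finset (Fin (n + 1) × Fin (n + 1)) :=
  Finset.univ.filter (fun a => a.1 ≠ a.2 ∧ a.2 ≠ 0 ∧ a.1 ≠ Fin.last n ∧
    ¬(a.1 = 0 ∧ a.2 = Fin.last n))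

/-- A simple directed `(0,n)`-path in `D̃_n`, encoded by its arc set: there is an
injective map `f` from `Fin (k+1)` to the nodes with `f 0 = 0` and `f k = n` whose
consecutive pairs are exactly the arcs of `P` (so `P` has `k` arcs). -/
def IsTildePath (n : ℕ) (P : Finset (Fin (n + 1) × Fin (n + 1))) : Prop :=
  P ⊆ tA n ∧ ∃ (k : ℕ) (f : Fin (k + 1) → Fin (n + 1)), Function.Injective f ∧
    f 0 = 0 ∧ f (Fin.last k) = Fin.last n ∧
    P = Finset.image (fun i : Fin k => (f (Fin.castSucc i), f (Fin.succ i))) Finset.univ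

/-- The cardinality constrained path polytope `P_{0,n-path}^c(D̃_n)`: the convex hull of
the incidence vectors of simple `(0,n)`-paths whose cardinality is `c p` for some `p`. -/
noncomputable def pathPolytope (n : ℕ) {m : ℕ} (c : Fin m → ℕ) :
    Set (Fin (n + 1) → Fin (n + 1) → ℝ) :=
  convexHull ℝ {x | ∃ P, IsTildePath n P ∧ (∃ p, P.card = c p) ∧ x = incVec P}

/-- `x(δ^out(i))` in `D̃_n`. -/
noncomputable def outT (n : ℕ) (x : Fin (n + 1) → Fin (n + 1) → ℝ) (i : Fin (n + 1)) :
    ℝ :=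
  ∑ a ∈ (tA n).filter (fun a => a.1 = i), x a.1 a.2

/-- `x(δ^in(i))` in `D̃_n`. -/
noncomputable def inT (n : ℕ) (x : Fin (n + 1) → Fin (n + 1) → ℝ) (i : Fin (n + 1)) :
    ℝ :=
  ∑ a ∈ (tA n).filter (fun a => a.2 = i), x a.1 a.2

/-- The valid inequality `f x ≥ b` defines a facet of `P`: it is valid and its face has
dimension `(dim P) - 1`. -/
def IsFacetGE {V : Type*} [AddCommGroup V] [Module ℝ V] (P : Set V) (f : V → ℝ) (b : ℝ) :
    Prop :=
  (∀ x ∈ P, b ≤ f x) ∧ adim {x ∈ P | f x = b} + 1 = adim P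

section ArcSets

variable {V : Type*} [DecidableEq V]

/-- The arcs `(f i, f (i + 1))` traversed by the sequence of nodes `f`. -/
def walkArcs {k : ℕ} (f : Fin (k + 1) → V) : Finset (V × V) :=
  univ.image fun i : Fin k => (f i.castSucc, f i.succ)

lemma mem_walkArcs {k : ℕ} {f : Fin (k + 1) → V} {a : V × V} :
    a ∈ walkArcs f ↔ ∃ i : Fin k, (f i.castSucc, f i.succ) = a := by
  simp [walkArcs]

lemma card_filter_walkArcs {k : ℕ} {f : Fin (k + 1) → V} (hf : Function.Injective f)
    (p : V × V → Prop) [DecidablePred p] :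
    #((walkArcs f).filter p) = #{i : Fin k | p (f i.castSucc, f i.succ)} := by
  rw [walkArcs, filter_image, card_image_of_injective]
  intro i j h
  exact Fin.castSucc_injective k (hf (Prod.ext_iff.1 h).1)

lemma card_walkArcs {k : ℕ} {f : Fin (k + 1) → V} (hf : Function.Injective f) :
    #(walkArcs f) = k := by
  simpa using card_filter_walkArcs hf (fun _ => True)

/-- Flow conservation along an injective sequence of nodes. -/
lemma card_out_add_eq_card_in_add {k : ℕ} {f : Fin (k + 1) → V} (hf : Function.Injective f)
    (v : V) :
    #((walkArcs f).filter (fun a => a.1 = v)) + (if f (Fin.last k) = v then 1 else 0) =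
      (if f 0 = v then 1 else 0) + #((walkArcs f).filter (fun a => a.2 = v)) := by
  simp only [card_filter_walkArcs hf, card_filter]
  rw [← Fin.sum_univ_castSucc (fun i => if f i = v then 1 else 0),
    ← Fin.sum_univ_succ (fun i => if f i = v then 1 else 0)]

lemma card_out_walkArcs_le_one {k : ℕ} {f : Fin (k + 1) → V} (hf : Function.Injective f)
    (v : V) : #((walkArcs f).filter (fun a => a.1 = v)) ≤ 1 := by
  rw [card_filter_walkArcs hf, card_le_one]
  intro i hi j hj
  simp only [mem_filter, mem_univ, true_and] at hi hj
  exact Fin.castSucc_injective k (hf (hi.trans hj.symm))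

lemma card_in_walkArcs_le_one {k : ℕ} {f : Fin (k + 1) → V} (hf : Function.Injective f)
    (v : V) : #((walkArcs f).filter (fun a => a.2 = v)) ≤ 1 := by
  rw [card_filter_walkArcs hf, card_le_one]
  intro i hi j hj
  simp only [mem_filter, mem_univ, true_and] at hi hj
  exact Fin.succ_injective k (hf (hi.trans hj.symm))

/-- An injective sequence of nodes starting in `S` crosses the cut of `S` at least as often as it
enters any fixed node outside `S`. -/
lemma card_in_walkArcs_le_card_cut {k : ℕ} {f : Fin (k + 1) → V} (hf : Function.Injective f)
    {S : Finset V} (h0 : f 0 ∈ S) {v : V} (hv : v ∉ S) :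
    #((walkArcs f).filter (fun a => a.2 = v)) ≤
      #((walkArcs f).filter (fun a => a.1 ∈ S ∧ a.2 ∉ S)) := by
  by_cases hcut : ((walkArcs f).filter (fun a => a.1 ∈ S ∧ a.2 ∉ S)).Nonempty
  · exact (card_in_walkArcs_le_one hf v).trans hcut.card_pos
  · have hS : ∀ i, f i ∈ S := by
      intro i
      induction i using Fin.induction with
      | zero => exact h0
      | succ i ih =>
        by_contra h
        exact hcut ⟨_, mem_filter.2 ⟨mem_walkArcs.2 ⟨i, rfl⟩, ih, h⟩⟩
    rw [filter_eq_empty_iff.2, card_empty]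
    · exact Nat.zero_le _
    · rintro a ha rfl
      obtain ⟨i, rfl⟩ := mem_walkArcs.1 ha
      exact hv (hS _)

lemma card_out_mem_walkArcs_lt {k : ℕ} {f : Fin (k + 1) → V} (hf : Function.Injective f)
    {W : Finset V} (hW : f (Fin.last k) ∈ W) :
    #((walkArcs f).filter (fun a => a.1 ∈ W)) < #W := by
  rw [card_filter_walkArcs hf, ← card_erase_add_one hW, Nat.lt_succ_iff]
  refine card_le_card_of_injOn (fun i => f i.castSucc) ?_
    (hf.comp (Fin.castSucc_injective k)).injOn
  intro i hi
  simp only [coe_filter, mem_univ, true_and, Set.mem_ofPred_eq] at hi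
  exact mem_coe.2 (mem_erase.2 ⟨fun h => (Fin.castSucc_lt_last i).ne (hf h), hi⟩)

/-- A finite arc set with in- and out-degrees at most one in which every entered node other than
`t` can be left, and in which `s` has an outgoing but no incoming arc, contains an
`(s,t)`-path. -/
lemma exists_injective_walkArcs_subset [Finite V] {A : Finset (V × V)} {s t : V}
    (hs : ∃ v, (s, v) ∈ A) (hs' : ∀ u, (u, s) ∉ A)
    (hin : ∀ u u' v, (u, v) ∈ A → (u', v) ∈ A → u = u')
    (hout : ∀ u v, (u, v) ∈ A → v ≠ t → ∃ w, (v, w) ∈ A) :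
    ∃ (k : ℕ) (f : Fin (k + 1) → V), Function.Injective f ∧ f 0 = s ∧ f (Fin.last k) = t ∧
      walkArcs f ⊆ A := by
  classical
  have hex : ∀ v, ∃ w, (∃ w', (v, w') ∈ A) → (v, w) ∈ A := fun v => by
    by_cases h : ∃ w', (v, w') ∈ A
    · exact ⟨h.choose, fun _ => h.choose_spec⟩
    · exact ⟨v, fun h' => (h h').elim⟩
  choose next hnext using hex
  set g : ℕ → V := fun i => next^[i] s with hg
  have hstep : ∀ i, g (i + 1) = next (g i) := fun i => Function.iterate_succ_apply' _ _ _
  have harc : ∀ k, (∀ i, 0 < i → i < k → g i ≠ t) → ∀ i < k, (g i, g (i + 1)) ∈ A := by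
    intro k hk i hi
    induction i with
    | zero => rw [hstep]; exact hnext _ hs
    | succ i ih =>
      rw [hstep (i + 1)]
      exact hnext _ (hout _ _ (ih (by omega)) (hk _ (by omega) hi))
  have hne : ∀ k, (∀ i < k, (g i, g (i + 1)) ∈ A) → ∀ i j, i < j → j ≤ k → g i ≠ g j := by
    intro k hk i
    induction i with
    | zero =>
      rintro (_ | j) hij hj h
      · omega
      · exact hs' (g j) (by
          have := hk j (by omega)
          rwa [← h] at this)
    | succ i ih =>
      rintro (_ | j) hij hj h
      · omega
      · have h1 := hk i (by omega)
        have h2 := hk j (by omega)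
        rw [← h] at h2
        exact ih j (by omega) (by omega) (hin _ _ _ h1 h2)
  have hreach : ∃ k, 0 < k ∧ g k = t := by
    by_contra! h
    refine not_injective_infinite_finite g fun i j hij => ?_
    by_contra hij'
    have hall : ∀ k, ∀ i < k, (g i, g (i + 1)) ∈ A := fun k => harc k fun i hi _ => h i hi
    rcases Nat.lt_or_gt_of_ne hij' with hlt | hlt
    · exact hne j (hall j) i j hlt le_rfl hij
    · exact hne i (hall i) j i hlt le_rfl hij.symm
  have hk := Nat.find_spec hreach
  have hmin := fun i => Nat.find_min (H := hreach) (m := i)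
  set k := Nat.find hreach
  have hA := harc k fun i hi hik h => hmin i hik ⟨hi, h⟩
  refine ⟨k, fun i => g i, fun i j hij => ?_, rfl, by simpa using hk.2, fun a ha => ?_⟩
  · by_contra hij'
    rcases lt_or_gt_of_ne hij' with hlt | hlt
    · exact hne k hA i j hlt (by omega) hij
    · exact hne k hA j i hlt (by omega) hij.symm
  · obtain ⟨i, rfl⟩ := mem_walkArcs.1 ha
    exact hA i i.2

end ArcSets

lemma sum_filter_incVec {n : ℕ} {P : Finset (Fin (n + 1) × Fin (n + 1))} (hP : P ⊆ tA n)
    (p : Fin (n + 1) × Fin (n + 1) → Prop) [DecidablePred p] :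
    ∑ a ∈ (tA n).filter p, incVec P a.1 a.2 = #(P.filter p) := by
  simp only [incVec, Prod.mk.eta, sum_boole]
  congr 2
  ext a
  simp only [mem_filter]
  exact ⟨fun h => ⟨h.2, h.1.2⟩, fun h => ⟨⟨hP h.1, h.2⟩, h.1⟩⟩

lemma sum_incVec {n : ℕ} {P : Finset (Fin (n + 1) × Fin (n + 1))} (hP : P ⊆ tA n) :
    ∑ a ∈ tA n, incVec P a.1 a.2 = #P := by
  simpa using sum_filter_incVec hP (fun _ => True)

lemma sum_outT_incVec {n : ℕ} {P : Finset (Fin (n + 1) × Fin (n + 1))} (hP : P ⊆ tA n)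
    (W : Finset (Fin (n + 1))) :
    ∑ i ∈ W, outT n (incVec P) i = #(P.filter (fun a => a.1 ∈ W)) := by
  simp only [outT, sum_filter_incVec hP]
  rw [card_eq_sum_card_fiberwise (s := P.filter (fun a => a.1 ∈ W)) (t := W) (f := Prod.fst)
    (fun a ha => (mem_filter.1 ha).2)]
  push_cast
  refine sum_congr rfl fun i hi => ?_
  congr 2
  ext a
  simp only [mem_filter]
  exact ⟨fun h => ⟨⟨h.1, h.2 ▸ hi⟩, h.2⟩, fun h => ⟨h.1.1, h.2⟩⟩

/-- A subset of `tA n` satisfying flow conservation, the degree constraints and the one-sided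
min-cut inequalities is a simple `(0,n)`-path. -/
lemma exists_eq_walkArcs {n : ℕ} {A : Finset (Fin (n + 1) × Fin (n + 1))}
    (hA : A ⊆ tA n)
    (hsource : outT n (incVec A) 0 - inT n (incVec A) 0 = 1)
    (hflow : ∀ i, i ≠ 0 → i ≠ Fin.last n → outT n (incVec A) i - inT n (incVec A) i = 0)
    (hsink : outT n (incVec A) (Fin.last n) - inT n (incVec A) (Fin.last n) = -1)
    (hdeg : ∀ i, i ≠ 0 → i ≠ Fin.last n → outT n (incVec A) i ≤ 1)
    (hcut : ∀ S : Finset (Fin (n + 1)), S ⊂ univ → 0 ∈ S → Fin.last n ∈ S → ∀ j ∉ S,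
      0 ≤ (∑ a ∈ (tA n).filter (fun a => a.1 ∈ S ∧ a.2 ∉ S), incVec A a.1 a.2)
        - inT n (incVec A) j) :
    ∃ (k : ℕ) (f : Fin (k + 1) → Fin (n + 1)), Function.Injective f ∧
      f 0 = 0 ∧ f (Fin.last k) = Fin.last n ∧ A = walkArcs f := by
  simp only [outT, inT, sum_filter_incVec hA] at hsource hflow hsink hdeg hcut
  have harc : ∀ u v, (u, v) ∈ A → v ≠ 0 ∧ u ≠ Fin.last n := fun u v h => by
    have := hA h
    simp only [tA, mem_filter] at this
    exact ⟨this.2.2.1, this.2.2.2.1⟩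
  have hin0 : #(A.filter (fun a => a.2 = 0)) = 0 :=
    card_eq_zero.2 (filter_eq_empty_iff.2 fun a ha h => (harc a.1 a.2 ha).1 h)
  have houtn : #(A.filter (fun a => a.1 = Fin.last n)) = 0 :=
    card_eq_zero.2 (filter_eq_empty_iff.2 fun a ha h => (harc a.1 a.2 ha).2 h)
  have hout0 : #(A.filter (fun a => a.1 = 0)) = 1 := by
    rw [hin0, Nat.cast_zero] at hsource
    exact_mod_cast (by linarith : (#(A.filter (fun a => a.1 = 0)) : ℝ) = 1)
  have hinn : #(A.filter (fun a => a.2 = Fin.last n)) = 1 := by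
    rw [houtn, Nat.cast_zero] at hsink
    exact_mod_cast (by linarith : (#(A.filter (fun a => a.2 = Fin.last n)) : ℝ) = 1)
  have hbal : ∀ i, i ≠ 0 → i ≠ Fin.last n →
      #(A.filter (fun a => a.1 = i)) = #(A.filter (fun a => a.2 = i)) := fun i h0 h1 => by
    exact_mod_cast sub_eq_zero.1 (hflow i h0 h1)
  have hout_le : ∀ i, #(A.filter (fun a => a.1 = i)) ≤ 1 := fun i => by
    by_cases h0 : i = 0
    · rw [h0, hout0]
    by_cases h1 : i = Fin.last n
    · rw [h1, houtn]; exact Nat.zero_le _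
    exact_mod_cast hdeg i h0 h1
  have hin_le : ∀ i, #(A.filter (fun a => a.2 = i)) ≤ 1 := fun i => by
    by_cases h0 : i = 0
    · rw [h0, hin0]; exact Nat.zero_le _
    by_cases h1 : i = Fin.last n
    · rw [h1, hinn]
    exact hbal i h0 h1 ▸ hout_le i
  have hout_unique : ∀ u v v', (u, v) ∈ A → (u, v') ∈ A → v = v' := fun u v v' h h' =>
    (Prod.ext_iff.1 (card_le_one.1 (hout_le u) _ (mem_filter.2 ⟨h, rfl⟩) _
      (mem_filter.2 ⟨h', rfl⟩))).2
  have hin_unique : ∀ u u' v, (u, v) ∈ A → (u', v) ∈ A → u = u' := fun u u' v h h' =>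
    (Prod.ext_iff.1 (card_le_one.1 (hin_le v) _ (mem_filter.2 ⟨h, rfl⟩) _
      (mem_filter.2 ⟨h', rfl⟩))).1
  have hout_ex : ∀ u v, (u, v) ∈ A → v ≠ Fin.last n → ∃ w, (v, w) ∈ A := fun u v h hv => by
    have hpos : 0 < #(A.filter (fun a => a.1 = v)) := by
      rw [hbal v (harc u v h).1 hv]
      exact card_pos.2 ⟨_, mem_filter.2 ⟨h, rfl⟩⟩
    obtain ⟨⟨v', w⟩, ha⟩ := card_pos.1 hpos
    obtain ⟨haA, rfl⟩ := mem_filter.1 ha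
    exact ⟨w, haA⟩
  have hin_ex : ∀ u v, (u, v) ∈ A → u ≠ 0 → ∃ w, (w, u) ∈ A := fun u v h hu => by
    have hpos : 0 < #(A.filter (fun a => a.2 = u)) := by
      rw [← hbal u hu (harc u v h).2]
      exact card_pos.2 ⟨_, mem_filter.2 ⟨h, rfl⟩⟩
    obtain ⟨⟨w, u'⟩, ha⟩ := card_pos.1 hpos
    obtain ⟨haA, rfl⟩ := mem_filter.1 ha
    exact ⟨w, haA⟩
  have hs : ∃ v, (0, v) ∈ A := by
    obtain ⟨⟨u, w⟩, ha⟩ := card_pos.1 (hout0.symm ▸ Nat.one_pos)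
    obtain ⟨ha, h⟩ := mem_filter.1 ha
    exact ⟨w, by simpa only [← h] using ha⟩
  obtain ⟨k, f, hf, hf0, hfl, hsub⟩ := exists_injective_walkArcs_subset hs
    (fun u h => (harc u 0 h).1 rfl) hin_unique hout_ex
  refine ⟨k, f, hf, hf0, hfl, Subset.antisymm ?_ hsub⟩
  have hwalk : ∀ u v, (u, v) ∈ A → u ∈ Set.range f → (u, v) ∈ walkArcs f := by
    rintro _ v h ⟨i, rfl⟩
    induction i using Fin.lastCases with
    | last => exact ((harc _ _ h).2 hfl).elim
    | cast i =>
      have hi : (f i.castSucc, f i.succ) ∈ walkArcs f := mem_walkArcs.2 ⟨i, rfl⟩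
      rwa [hout_unique _ _ _ h (hsub hi)]
  have hhead : ∀ u v, (u, v) ∈ A → v ∈ Set.range f := by
    intro u v h
    by_contra hv
    have hvS : v ∉ univ.image f := by simpa using hv
    have := hcut (univ.image f) (ssubset_univ_iff.2 fun h' => hvS (h' ▸ mem_univ v))
      (mem_image.2 ⟨0, mem_univ _, hf0⟩) (mem_image.2 ⟨_, mem_univ _, hfl⟩) v hvS
    rw [sub_nonneg, Nat.cast_le] at this
    have hpos : 0 < #(A.filter (fun a => a.2 = v)) := card_pos.2 ⟨_, mem_filter.2 ⟨h, rfl⟩⟩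
    obtain ⟨⟨a, b⟩, hab⟩ := card_pos.1 (hpos.trans_le this)
    obtain ⟨hab, ha, hb⟩ := mem_filter.1 hab
    obtain ⟨i, hi⟩ := mem_walkArcs.1 (hwalk a b hab (by simpa using ha))
    exact hb (mem_image.2 ⟨i.succ, mem_univ _, (Prod.ext_iff.1 hi).2⟩)
  rintro ⟨u, v⟩ h
  refine hwalk u v h ?_
  by_cases hu : u = 0
  · exact ⟨0, hf0.trans hu.symm⟩
  · obtain ⟨w, hw⟩ := hin_ex u v h hu
    exact hhead w u hw

/-- A number between the first and last term of a finite sequence is a term of it or lies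
strictly between two consecutive terms. -/
lemma exists_eq_or_between {m : ℕ} (hm : 0 < m) (c : Fin m → ℕ) {k : ℕ}
    (hlo : c ⟨0, hm⟩ ≤ k) (hhi : k ≤ c ⟨m - 1, by omega⟩) :
    (∃ p, k = c p) ∨ ∃ p q : Fin m, (q : ℕ) = p + 1 ∧ c p < k ∧ k < c q := by
  by_contra! h
  obtain ⟨hne, hgap⟩ := h
  have hlt : ∀ i (hi : i < m), c ⟨i, hi⟩ < k := by
    intro i
    induction i with
    | zero => exact fun _ => lt_of_le_of_ne hlo (hne _).symm
    | succ i ih =>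
      exact fun hi => lt_of_le_of_ne (hgap ⟨i, by omega⟩ ⟨i + 1, hi⟩ rfl (ih _)) (hne _).symm
  exact (hlt (m - 1) (by omega)).not_ge hhi

/-- **IP characterization of cardinality constrained `(0,n)`-paths (model (7)).**  Let
`c` be a cardinality sequence with `2 ≤ c 0 < ⋯ < c (m-1) ≤ n`.  A `0/1`-vector `x`
supported on `Ã_n` is the incidence vector of a simple directed `(0,n)`-path in `D̃_n` of
cardinality `c p` for some `p` if and only if it satisfies the flow conservation
constraints, the degree constraints, the one-sided min-cut inequalities, the cardinality
bounds, and the cardinality forcing inequalities. -/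
theorem path_IP_characterization
    (n : ℕ) (m : ℕ) (hm : 1 ≤ m) (c : Fin m → ℕ) (hmono : StrictMono c)
    (hc2 : ∀ p, 2 ≤ c p) (hcn : ∀ p, c p ≤ n)
    (x : Fin (n + 1) → Fin (n + 1) → ℝ)
    (h01 : ∀ a ∈ tA n, x a.1 a.2 = 0 ∨ x a.1 a.2 = 1)
    (hsupp : ∀ a : Fin (n + 1) × Fin (n + 1), a ∉ tA n → x a.1 a.2 = 0) :
    (∃ P : Finset (Fin (n + 1) × Fin (n + 1)), IsTildePath n P ∧ (∃ p, P.card = c p) ∧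
        ∀ i j, x i j = incVec P i j) ↔
      ((outT n x 0 - inT n x 0 = 1) ∧
       (∀ i : Fin (n + 1), i ≠ 0 → i ≠ Fin.last n → outT n x i - inT n x i = 0) ∧
       (outT n x (Fin.last n) - inT n x (Fin.last n) = -1) ∧
       (∀ i : Fin (n + 1), i ≠ 0 → i ≠ Fin.last n → outT n x i ≤ 1) ∧
       (∀ S : Finset (Fin (n + 1)), S ⊂ Finset.univ → 0 ∈ S → Fin.last n ∈ S →
          ∀ j ∉ S,
          0 ≤ (∑ a ∈ (tA n).filter (fun a => a.1 ∈ S ∧ a.2 ∉ S), x a.1 a.2)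
              - inT n x j) ∧
       ((c ⟨0, by omega⟩ : ℝ) ≤ ∑ a ∈ tA n, x a.1 a.2) ∧
       ((∑ a ∈ tA n, x a.1 a.2) ≤ (c ⟨m - 1, by omega⟩ : ℝ)) ∧
       (∀ W : Finset (Fin (n + 1)), 0 ∈ W → Fin.last n ∈ W →
          ∀ p q : Fin m, (q : ℕ) = (p : ℕ) + 1 →
          c p + 1 < W.card → W.card < c q + 1 →
          ((c q : ℝ) - W.card + 1) * (∑ i ∈ W, outT n x i)
            - ((W.card : ℝ) - 1 - c p) * (∑ i ∈ Finset.univ \ W, outT n x i)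
            ≤ (c p : ℝ) * ((c q : ℝ) - W.card + 1))) := by
  constructor
  · rintro ⟨P, ⟨hP, k, f, hf, hf0, hfl, hPf⟩, ⟨p₀, hp₀⟩, hx⟩
    obtain rfl : x = incVec P := funext fun i => funext (hx i)
    change P = walkArcs f at hPf
    have hn : 0 < n := by have := hc2 p₀; have := hcn p₀; omega
    have hn0 : Fin.last n ≠ 0 := fun h => hn.ne' (by simpa using congrArg Fin.val h)
    have hbal : ∀ i, outT n (incVec P) i + (if Fin.last n = i then 1 else 0) =
        (if 0 = i then 1 else 0) + inT n (incVec P) i := fun i => by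
      have := card_out_add_eq_card_in_add hf i
      rw [hf0, hfl, ← hPf] at this
      simp only [outT, inT, sum_filter_incVec hP]
      exact_mod_cast this
    refine ⟨?_, fun i h0 hl => ?_, ?_, fun i _ _ => ?_, fun S _ h0 _ j hj => ?_, ?_, ?_,
      fun W _ hlW p q hpq hpW hWq => ?_⟩
    · have := hbal 0
      rw [if_neg hn0, if_pos rfl] at this
      linarith
    · have := hbal i
      rw [if_neg hl.symm, if_neg h0.symm] at this
      linarith
    · have := hbal (Fin.last n)
      rw [if_pos rfl, if_neg hn0.symm] at this
      linarith
    · rw [outT, sum_filter_incVec hP, hPf]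
      exact_mod_cast card_out_walkArcs_le_one hf i
    · rw [inT, sum_filter_incVec hP, sum_filter_incVec hP, sub_nonneg, hPf]
      exact_mod_cast card_in_walkArcs_le_card_cut hf (hf0.symm ▸ h0) hj
    · rw [sum_incVec hP, hp₀]
      exact_mod_cast hmono.monotone (Fin.mk_le_of_le_val (Nat.zero_le _))
    · rw [sum_incVec hP, hp₀]
      exact_mod_cast hmono.monotone (Fin.mk_le_mk.2 (by omega))
    · have hsplit := card_filter_add_card_filter_not (s := P) (fun a => a.1 ∈ W)
      have hlt : #(P.filter (fun a => a.1 ∈ W)) < #W := by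
        rw [hPf]
        exact card_out_mem_walkArcs_lt hf (hfl.symm ▸ hlW)
      rw [sum_outT_incVec hP, sum_outT_incVec hP]
      simp only [mem_sdiff, mem_univ, true_and]
      rw [hp₀] at hsplit
      set r := #(P.filter (fun a => a.1 ∈ W))
      set r' := #(P.filter (fun a => a.1 ∉ W))
      have hcase : c p₀ ≤ c p ∨ c q ≤ c p₀ := by
        rcases le_or_gt p₀ p with h | h
        · exact Or.inl (hmono.monotone h)
        · exact Or.inr (hmono.monotone (Fin.le_def.2 (by have := Fin.lt_def.1 h; omega)))
      have h1 : (c p : ℝ) + 1 < #W := by exact_mod_cast hpW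
      have h2 : (#W : ℝ) < c q + 1 := by exact_mod_cast hWq
      have h3 : (r : ℝ) + 1 ≤ #W := by exact_mod_cast hlt
      have h4 : (r : ℝ) + r' = c p₀ := by exact_mod_cast hsplit
      have h5 : (0 : ℝ) ≤ r' := Nat.cast_nonneg _
      have h6 : (0 : ℝ) ≤ c p := Nat.cast_nonneg _
      rcases hcase with h | h
      · have h7 : (c p₀ : ℝ) ≤ c p := by exact_mod_cast h
        nlinarith
      · have h7 : (c q : ℝ) ≤ c p₀ := by exact_mod_cast h
        have h8 : (c q : ℝ) - r ≤ r' := by linarith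
        nlinarith [mul_le_mul_of_nonneg_left h8 (by linarith : (0 : ℝ) ≤ #W - 1 - c p)]
  · rintro ⟨hsource, hflow, hsink, hdeg, hcut, hlo, hhi, hforce⟩
    classical
    have hA : (tA n).filter (fun a => x a.1 a.2 = 1) ⊆ tA n := filter_subset _ _
    have hx : x = incVec ((tA n).filter (fun a => x a.1 a.2 = 1)) := by
      ext i j
      by_cases h : (i, j) ∈ tA n
      · rcases h01 _ h with h' | h' <;> simp_all [incVec]
      · simp [incVec, h, hsupp _ h]
    set A := (tA n).filter (fun a => x a.1 a.2 = 1)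
    clear_value A
    subst hx
    obtain ⟨k, f, hf, hf0, hfl, hAf⟩ := exists_eq_walkArcs hA hsource hflow hsink hdeg hcut
    have hk : #A = k := by rw [hAf, card_walkArcs hf]
    rw [sum_incVec hA, Nat.cast_le, hk] at hlo hhi
    refine ⟨A, ⟨hA, k, f, hf, hf0, hfl, hAf⟩, ?_, fun _ _ => rfl⟩
    rw [hk]
    refine (exists_eq_or_between hm c hlo hhi).resolve_right ?_
    rintro ⟨p, q, hpq, hpk, hkq⟩
    have hW : #(univ.image f) = k + 1 := by simp [card_image_of_injective _ hf]
    have htail : ∀ a ∈ A, a.1 ∈ univ.image f := fun a ha => by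
      obtain ⟨i, rfl⟩ := mem_walkArcs.1 (hAf ▸ ha)
      exact mem_image_of_mem _ (mem_univ _)
    have := hforce (univ.image f) (mem_image.2 ⟨0, mem_univ _, hf0⟩)
      (mem_image.2 ⟨_, mem_univ _, hfl⟩) p q hpq (by omega) (by omega)
    rw [sum_outT_incVec hA, sum_outT_incVec hA, filter_true_of_mem htail,
      filter_false_of_mem (fun a ha h => (mem_sdiff.1 h).2 (htail a ha)), hW, hk] at this
    push_cast [card_empty] at this
    have h1 : (c p : ℝ) < k := by exact_mod_cast hpk
    have h2 : (k : ℝ) < c q := by exact_mod_cast hkq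
    nlinarith [mul_pos (sub_pos.2 h1) (sub_pos.2 h2)]
end
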